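/- Let 0 ≠ ν < 1, 1 ≤ p < ∞, δ ∈ ℝ. The exotic Bessel heat semigroup maximal operator W̃_*^ν, considered on the measure space (ℝ₊, x^δ dx), is of strong type (p,p) if and only if p > 1 and 2νp − 1 < δ < 2p − 1. Moreover, W̃_*^ν is of strong type (∞,∞) if and only if ν < 0. -/

import Mathlib

open MeasureTheory Set ENNReal
open scoped NNReal

noncomputable section

/-- The measure `x^δ dx` on `(0,∞)`. -/
def powMeasure (δ : ℝ) : Measure ℝ :=
  (volume.restrict (Ioi (0:ℝ))).withDensity (fun x => ENNReal.ofReal (x ^ δ))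

/-- `f ∈ L^p(ℝ₊, x^δ dx)` for a real exponent `p`. -/
def MemLpPow (f : ℝ → ℝ) (p δ : ℝ) : Prop :=
  AEMeasurable f (powMeasure δ) ∧
    ∫⁻ x, ENNReal.ofReal |f x| ^ p ∂(powMeasure δ) < ⊤

/-- `T` is of strong type `(p,p)` with respect to `(ℝ₊, x^δ dx)`. -/
def IsStrongType (T : (ℝ → ℝ) → (ℝ → ℝ)) (p δ : ℝ) : Prop :=
  ∃ C : ℝ≥0, ∀ f : ℝ → ℝ, MemLpPow f p δ →
    ∫⁻ x, ENNReal.ofReal |T f x| ^ p ∂(powMeasure δ) ≤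
      C * ∫⁻ x, ENNReal.ofReal |f x| ^ p ∂(powMeasure δ)

/-- `T` is of strong type `(∞,∞)`, i.e. bounded on `L^∞(ℝ₊, dx)`. -/
def IsStrongTypeInfty (T : (ℝ → ℝ) → (ℝ → ℝ)) : Prop :=
  ∃ C : ℝ≥0, ∀ f : ℝ → ℝ,
    eLpNorm (T f) ⊤ (volume.restrict (Ioi (0:ℝ))) ≤
      C * eLpNorm f ⊤ (volume.restrict (Ioi (0:ℝ)))

/-- `T` is of weak type `(p,p)` with respect to `(ℝ₊, x^δ dx)`. -/
def IsWeakType (T : (ℝ → ℝ) → (ℝ → ℝ)) (p δ : ℝ) : Prop :=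
  ∃ C : ℝ≥0, ∀ f : ℝ → ℝ, MemLpPow f p δ → ∀ l : ℝ, 0 < l →
    ENNReal.ofReal (l ^ p) * powMeasure δ {y | l < |T f y|} ≤
      C * ∫⁻ x, ENNReal.ofReal |f x| ^ p ∂(powMeasure δ)

/-- `T` is of restricted weak type `(p,p)` with respect to `(ℝ₊, x^δ dx)`:
the weak type inequality holds uniformly over indicator functions of sets of
finite `x^δ dx` measure. -/
def IsRestrictedWeakType (T : (ℝ → ℝ) → (ℝ → ℝ)) (p δ : ℝ) : Prop :=
  ∃ C : ℝ≥0, ∀ E : Set ℝ, MeasurableSet E → powMeasure δ E < ⊤ → ∀ l : ℝ, 0 < l →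
    ENNReal.ofReal (l ^ p) * powMeasure δ {y | l < |T (E.indicator 1) y|} ≤
      C * powMeasure δ E

/-- The modified Bessel function `I_μ` (for `μ > -1`, `w > 0`). -/
def besselI (μ : ℝ) (w : ℝ) : ℝ :=
  ∑' n : ℕ, (w / 2) ^ (2 * (n : ℝ) + μ) / (Real.Gamma ((n : ℝ) + 1) * Real.Gamma ((n : ℝ) + μ + 1))

/-- The classical Bessel heat kernel `W_t^ν(x,y)` (for `ν > -1`). -/
def Wcls (ν t x y : ℝ) : ℝ :=
  (2 * t)⁻¹ * (x * y) ^ (-ν) * Real.exp (-(x ^ 2 + y ^ 2) / (4 * t)) * besselI ν (x * y / (2 * t))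

/-- The exotic Bessel heat kernel `W̃_t^ν(x,y)` (for `ν < 1`). -/
def Wexo (ν t x y : ℝ) : ℝ :=
  (x * y) ^ (-(2 * ν)) * Wcls (-ν) t x y

/-- The measure `dη_ν(x) = x^{2ν+1} dx` on `(0,∞)`. -/
def etaMeasure (ν : ℝ) : Measure ℝ :=
  (volume.restrict (Ioi (0:ℝ))).withDensity (fun x => ENNReal.ofReal (x ^ (2 * ν + 1)))

/-- `W̃_t^ν f(x) = ∫₀^∞ W̃_t^ν(x,y) f(y) dη_ν(y)`. -/
def WexoInt (ν t : ℝ) (f : ℝ → ℝ) (x : ℝ) : ℝ :=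
  ∫ y, Wexo ν t x y * f y ∂(etaMeasure ν)

/-- The exotic Bessel heat semigroup maximal operator `W̃_*^ν`. -/
def WexoMax (ν : ℝ) (f : ℝ → ℝ) (x : ℝ) : ℝ≥0∞ :=
  ⨆ t ∈ Ioi (0:ℝ), ENNReal.ofReal |WexoInt ν t f x|

lemma Gamma_add_natCast_eq_mul_prod {s : ℝ} (hs : 0 < s) (n : ℕ) :
    Real.Gamma (s + n) = Real.Gamma s * ∏ j ∈ Finset.range n, (s + j) := by
  induction n with
  | zero => simp
  | succ k ih =>
    have : s + (k + 1 : ℕ) = (s + k) + 1 := by push_cast; ring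
    rw [this, Real.Gamma_add_one (by positivity), ih, Finset.prod_range_succ]
    ring

open Filter Topology in
lemma tendsto_rpow_mul_factorial_div_Gamma {s : ℝ} (hs : 0 < s) :
    Tendsto (fun n : ℕ => (n : ℝ) ^ s * n.factorial / Real.Gamma (n + 1 + s)) atTop (𝓝 1) := by
  have h := (Real.GammaSeq_tendsto_Gamma s).div_const (Real.Gamma s)
  rw [div_self (Real.Gamma_pos_of_pos hs).ne'] at h
  refine h.congr fun n => ?_
  have e : (n : ℝ) + 1 + s = s + (n + 1 : ℕ) := by push_cast; ring
  rw [e, Gamma_add_natCast_eq_mul_prod hs, Real.GammaSeq, div_div, mul_comm (Real.Gamma s)]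

open Filter Topology in
lemma exists_Gamma_succ_add_le {α β : ℝ} (hα : 0 < α) (hβ : 0 < β) :
    ∃ C : ℝ, 0 < C ∧ ∀ n : ℕ, 0 < n →
      Real.Gamma (n + 1 + α) ≤ C * (n : ℝ) ^ (α - β) * Real.Gamma (n + 1 + β) := by
  have h := (tendsto_rpow_mul_factorial_div_Gamma hβ).div
    (tendsto_rpow_mul_factorial_div_Gamma hα) one_ne_zero
  obtain ⟨C, hC⟩ := h.bddAbove_range
  refine ⟨max C 1, by positivity, fun n hn => ?_⟩
  have h1 := hC ⟨n, rfl⟩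
  have hn' : (0 : ℝ) < n := by exact_mod_cast hn
  have ga := Real.Gamma_pos_of_pos (show 0 < (n : ℝ) + 1 + α by positivity)
  have gb := Real.Gamma_pos_of_pos (show 0 < (n : ℝ) + 1 + β by positivity)
  have hf : (0 : ℝ) < n.factorial := by exact_mod_cast n.factorial_pos
  have pa : (0 : ℝ) < (n : ℝ) ^ α := by positivity
  have pb : (0 : ℝ) < (n : ℝ) ^ β := by positivity
  have h2 : Real.Gamma (n + 1 + α) = ((n : ℝ) ^ β * n.factorial / Real.Gamma (n + 1 + β) /
      ((n : ℝ) ^ α * n.factorial / Real.Gamma (n + 1 + α))) *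
      ((n : ℝ) ^ (α - β) * Real.Gamma (n + 1 + β)) := by
    rw [Real.rpow_sub hn']
    field_simp
  rw [h2, mul_assoc]
  gcongr
  exact h1.trans (le_max_left _ _)

lemma exists_Gamma_add_le {α β : ℝ} (hα : 0 < α) (hβ : 0 < β) :
    ∃ C : ℝ, 0 < C ∧ ∀ n : ℕ,
      Real.Gamma (n + α) ≤ C * ((n : ℝ) + 1) ^ (α - β) * Real.Gamma (n + β) := by
  obtain ⟨C, hC, h⟩ := exists_Gamma_succ_add_le hα hβ
  refine ⟨C * (1 + β / α) ^ 2, by positivity, fun n => ?_⟩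
  have h1 := h (n + 1) n.succ_pos
  have key : ∀ γ : ℝ, 0 < γ → Real.Gamma ((n + 1 : ℕ) + 1 + γ) =
      (n + 1 + γ) * ((n + γ) * Real.Gamma (n + γ)) := by
    intro γ hγ
    have e1 : ((n + 1 : ℕ) : ℝ) + 1 + γ = (n + γ + 1) + 1 := by push_cast; ring
    rw [e1, Real.Gamma_add_one (by positivity), Real.Gamma_add_one (by positivity)]
    ring
  rw [key α hα, key β hβ] at h1
  push_cast at h1
  have ratio : ∀ m : ℝ, 0 ≤ m → m + β ≤ (1 + β / α) * (m + α) := by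
    intro m hm
    have : (1 + β / α) * (m + α) = m + β + (α + β / α * m) := by field_simp; ring
    rw [this]
    have : 0 ≤ α + β / α * m := by positivity
    linarith
  have r0 := ratio n (by positivity)
  have r1 := ratio (n + 1) (by positivity)
  have gb := Real.Gamma_pos_of_pos (show 0 < (n : ℝ) + β by positivity)
  have p0 : 0 < (n : ℝ) + α := by positivity
  have p1 : 0 < (n : ℝ) + 1 + α := by positivity
  have hp : (0 : ℝ) < ((n : ℝ) + 1) ^ (α - β) := by positivity
  have h2 : (n + 1 + β) * (n + β) ≤ (1 + β / α) ^ 2 * ((n + 1 + α) * (n + α)) := by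
    calc (n + 1 + β) * (n + β) ≤ ((1 + β / α) * (n + 1 + α)) * ((1 + β / α) * (n + α)) := by
          gcongr
      _ = _ := by ring
  have h3 : (((n : ℝ) + 1 + α) * (n + α)) * Real.Gamma (n + α) ≤ ((n + 1 + α) * (n + α)) *
      (C * (1 + β / α) ^ 2 * ((n : ℝ) + 1) ^ (α - β) * Real.Gamma (n + β)) := by
    calc _ = (↑n + 1 + α) * ((↑n + α) * Real.Gamma (↑n + α)) := by ring
      _ ≤ _ := h1
      _ = C * (↑n + 1) ^ (α - β) * Real.Gamma (↑n + β) * ((↑n + 1 + β) * (↑n + β)) := by ring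
      _ ≤ C * (↑n + 1) ^ (α - β) * Real.Gamma (↑n + β) *
          ((1 + β / α) ^ 2 * ((n + 1 + α) * (n + α))) := by gcongr
      _ = _ := by ring
  exact le_of_mul_le_mul_left h3 (by positivity)

/-- The `n`-th term of the series defining `besselI μ w`. -/
def besselTerm (μ w : ℝ) (n : ℕ) : ℝ :=
  (w / 2) ^ (2 * (n : ℝ) + μ) / (Real.Gamma ((n : ℝ) + 1) * Real.Gamma ((n : ℝ) + μ + 1))

lemma besselTerm_eq {μ w : ℝ} (hw : 0 < w) (n : ℕ) :
    besselTerm μ w n = (2 ^ (-μ) / √Real.pi) * w ^ μ * (w ^ (2 * n) / (2 * n).factorial) *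
      (Real.Gamma (n + 1 / 2) / Real.Gamma (n + (μ + 1))) := by
  have h := Real.Gamma_mul_Gamma_add_half (n + 1 / 2)
  have e1 : (n : ℝ) + 1 / 2 + 1 / 2 = n + 1 := by ring
  have e2 : 2 * ((n : ℝ) + 1 / 2) = (2 * n : ℕ) + 1 := by push_cast; ring
  have e3 : 1 - (((2 * n : ℕ) : ℝ) + 1) = -((2 * n : ℕ) : ℝ) := by ring
  rw [e1, e2, e3, Real.Gamma_nat_eq_factorial (2 * n), Real.rpow_neg (by norm_num),
    Real.rpow_natCast] at h
  have e4 : 2 * (n : ℝ) + μ = (2 * n : ℕ) + μ := by push_cast; ring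
  have hpi : 0 < √Real.pi := Real.sqrt_pos.mpr Real.pi_pos
  have hf : (0 : ℝ) < (2 * n).factorial := by exact_mod_cast (2 * n).factorial_pos
  have hg := Real.Gamma_pos_of_pos (show 0 < (n : ℝ) + 1 / 2 by positivity)
  have hg1 := Real.Gamma_pos_of_pos (show 0 < (n : ℝ) + 1 by positivity)
  have hh : Real.Gamma ((n : ℝ) + 1 / 2) =
      (2 * n).factorial * ((2 : ℝ) ^ (2 * n))⁻¹ * √Real.pi / Real.Gamma (n + 1) := by
    rw [← h]; field_simp
  rw [besselTerm, e4, Real.rpow_add (by positivity), Real.rpow_natCast, hh,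
    Real.div_rpow hw.le (by norm_num), Real.rpow_neg (by norm_num), div_pow, ← add_assoc]
  field_simp

lemma besselTerm_nonneg {μ w : ℝ} (hμ : -1 < μ) (hw : 0 < w) (n : ℕ) :
    0 ≤ besselTerm μ w n := by
  have h1 := Real.Gamma_pos_of_pos (show 0 < (n : ℝ) + 1 by positivity)
  have h2 := Real.Gamma_pos_of_pos
    (show 0 < (n : ℝ) + μ + 1 by have : (0 : ℝ) ≤ n := by positivity
                                 linarith)
  unfold besselTerm
  positivity

lemma exists_besselTerm_le {μ : ℝ} (hμ : -1 < μ) :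
    ∃ C : ℝ, 0 < C ∧ ∀ w : ℝ, 0 < w → ∀ n : ℕ, besselTerm μ w n ≤
      C * w ^ μ * (w ^ (2 * n) / (2 * n).factorial * ((n : ℝ) + 1) ^ (-(μ + 1 / 2))) := by
  obtain ⟨C, hC, h⟩ := exists_Gamma_add_le (α := 1 / 2) (β := μ + 1) (by norm_num) (by linarith)
  have hpi : 0 < √Real.pi := Real.sqrt_pos.mpr Real.pi_pos
  refine ⟨(2 ^ (-μ) / √Real.pi) * C, by positivity, fun w hw n => ?_⟩
  have hg := Real.Gamma_pos_of_pos
    (show 0 < (n : ℝ) + (μ + 1) by have : (0 : ℝ) ≤ n := by positivity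
                                   linarith)
  have h1 : Real.Gamma (n + 1 / 2) / Real.Gamma (n + (μ + 1)) ≤
      C * ((n : ℝ) + 1) ^ (-(μ + 1 / 2)) := by
    rw [div_le_iff₀ hg, show -(μ + 1 / 2) = 1 / 2 - (μ + 1) by ring]
    exact h n
  rw [besselTerm_eq hw]
  calc _ ≤ (2 ^ (-μ) / √Real.pi) * w ^ μ * (w ^ (2 * n) / (2 * n).factorial) *
      (C * ((n : ℝ) + 1) ^ (-(μ + 1 / 2))) := by gcongr
    _ = _ := by ring

lemma exists_le_besselTerm {μ : ℝ} (hμ : -1 < μ) :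
    ∃ c : ℝ, 0 < c ∧ ∀ w : ℝ, 0 < w → ∀ n : ℕ,
      c * w ^ μ * (w ^ (2 * n) / (2 * n).factorial * ((n : ℝ) + 1) ^ (-(μ + 1 / 2))) ≤
        besselTerm μ w n := by
  obtain ⟨C, hC, h⟩ := exists_Gamma_add_le (α := μ + 1) (β := 1 / 2) (by linarith) (by norm_num)
  have hpi : 0 < √Real.pi := Real.sqrt_pos.mpr Real.pi_pos
  refine ⟨(2 ^ (-μ) / √Real.pi) * C⁻¹, by positivity, fun w hw n => ?_⟩
  have hg := Real.Gamma_pos_of_pos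
    (show 0 < (n : ℝ) + (μ + 1) by have : (0 : ℝ) ≤ n := by positivity
                                   linarith)
  have h1 : C⁻¹ * ((n : ℝ) + 1) ^ (-(μ + 1 / 2)) ≤
      Real.Gamma (n + 1 / 2) / Real.Gamma (n + (μ + 1)) := by
    rw [le_div_iff₀ hg, Real.rpow_neg (by positivity), ← mul_inv, inv_mul_le_iff₀ (by positivity),
      show μ + 1 / 2 = μ + 1 - 1 / 2 by ring]
    exact h n
  rw [besselTerm_eq hw]
  calc _ = (2 ^ (-μ) / √Real.pi) * w ^ μ * (w ^ (2 * n) / (2 * n).factorial) *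
      (C⁻¹ * ((n : ℝ) + 1) ^ (-(μ + 1 / 2))) := by ring
    _ ≤ _ := by gcongr

/-- The `n`-th term of the power series of `Real.cosh`. -/
def coshTerm (w : ℝ) (n : ℕ) : ℝ := w ^ (2 * n) / (2 * n).factorial

lemma coshTerm_nonneg (w : ℝ) (n : ℕ) : 0 ≤ coshTerm w n := by
  unfold coshTerm; rw [pow_mul]; positivity

lemma hasSum_coshTerm_mul_succ (w : ℝ) :
    HasSum (fun n : ℕ => coshTerm w n * (n + 1)) (w * Real.sinh w / 2 + Real.cosh w) := by
  have h1 : HasSum (coshTerm w) (Real.cosh w) := Real.hasSum_cosh w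
  have h2 : HasSum (fun n : ℕ => coshTerm w n * n) (w * Real.sinh w / 2) := by
    have h3 := ((Real.hasSum_sinh w).mul_left w).div_const 2
    rw [← hasSum_nat_add_iff' 1]
    simp only [Finset.range_one, Finset.sum_singleton, Nat.cast_zero, mul_zero, sub_zero]
    convert! h3 using 2 with n
    rw [coshTerm, show 2 * (n + 1) = (2 * n + 1) + 1 by ring, Nat.factorial_succ (2 * n + 1)]
    have hf : ((2 * n + 1).factorial : ℝ) ≠ 0 := by exact_mod_cast (2 * n + 1).factorial_ne_zero
    push_cast
    field_simp
    ring
  convert! h2.add h1 using 2 with n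
  ring

lemma coshTerm_mul_pow_le {w : ℝ} (hw : 0 < w) (k n : ℕ) :
    coshTerm w n * ((1 + w) / (n + 1)) ^ k ≤
      ((k : ℝ) + 2) ^ k * ((1 + w) ^ (2 * n + k) / (2 * n + k).factorial) := by
  have h1 : ((2 * n + k).factorial : ℝ) ≤ (2 * n).factorial * (((k : ℝ) + 2) * (n + 1)) ^ k := by
    have h2 : (2 * n + k).factorial ≤ (2 * n).factorial * ((k + 2) * (n + 1)) ^ k := by
      rw [← Nat.factorial_mul_ascFactorial]
      gcongr
      exact (Nat.ascFactorial_le_pow_add _ _).trans (Nat.pow_le_pow_left (by nlinarith) _)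
    exact_mod_cast h2
  have f1 : (0 : ℝ) < (2 * n).factorial := by exact_mod_cast (2 * n).factorial_pos
  have f2 : (0 : ℝ) < (2 * n + k).factorial := by exact_mod_cast (2 * n + k).factorial_pos
  rw [coshTerm, div_pow, div_mul_div_comm, mul_div_assoc', div_le_div_iff₀ (by positivity) f2]
  calc w ^ (2 * n) * (1 + w) ^ k * (2 * n + k).factorial
      ≤ (1 + w) ^ (2 * n) * (1 + w) ^ k *
        ((2 * n).factorial * (((k : ℝ) + 2) * (n + 1)) ^ k) := by
        gcongr; linarith
    _ = _ := by rw [mul_pow, pow_add]; ring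

lemma exists_tsum_coshTerm_mul_le (k : ℕ) :
    ∃ C : ℝ, 0 < C ∧ ∀ w : ℝ, 0 < w →
      Summable (fun n : ℕ => coshTerm w n *
        (((1 + w) / (n + 1)) ^ k + ((1 + w) / (n + 1))⁻¹)) ∧
      ∑' n : ℕ, coshTerm w n * (((1 + w) / (n + 1)) ^ k + ((1 + w) / (n + 1))⁻¹) ≤
        C * Real.exp w := by
  refine ⟨((k : ℝ) + 2) ^ k * Real.exp 1 + 1, by positivity, fun w hw => ?_⟩
  have inj : Function.Injective (fun n : ℕ => 2 * n + k) := fun a b h => by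
    simp only at h; omega
  have se := Real.summable_pow_div_factorial (1 + w)
  have s1 : Summable (fun n : ℕ => ((k : ℝ) + 2) ^ k *
      ((1 + w) ^ (2 * n + k) / (2 * n + k).factorial)) :=
    (se.comp_injective inj).mul_left _
  have s2 : Summable (fun n : ℕ => coshTerm w n * ((1 + w) / (n + 1)) ^ k) :=
    s1.of_nonneg_of_le (fun n => mul_nonneg (coshTerm_nonneg w n) (by positivity))
      (coshTerm_mul_pow_le hw k)
  have b1 : ∑' n : ℕ, coshTerm w n * ((1 + w) / (n + 1)) ^ k ≤
      ((k : ℝ) + 2) ^ k * Real.exp (1 + w) := by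
    refine (s2.tsum_le_tsum (coshTerm_mul_pow_le hw k) s1).trans ?_
    rw [tsum_mul_left]
    gcongr
    rw [Real.exp_eq_exp_ℝ, NormedSpace.exp_eq_tsum_div]
    exact (se.comp_injective inj).tsum_le_tsum_of_inj _ inj
      (fun c _ => by positivity) (fun n => le_rfl) se
  have h3 := (hasSum_coshTerm_mul_succ w).div_const (1 + w)
  have e3 : (fun n : ℕ => coshTerm w n * (n + 1) / (1 + w)) =
      fun n : ℕ => coshTerm w n * ((1 + w) / (n + 1))⁻¹ := by
    ext n; rw [inv_div, mul_div_assoc]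
  rw [e3] at h3
  have e4 : (fun n : ℕ => coshTerm w n * (((1 + w) / (n + 1)) ^ k + ((1 + w) / (n + 1))⁻¹)) =
    fun n : ℕ => coshTerm w n * ((1 + w) / (n + 1)) ^ k +
      coshTerm w n * ((1 + w) / (n + 1))⁻¹ := by ext n; ring
  rw [e4]
  refine ⟨s2.add h3.summable, ?_⟩
  rw [s2.tsum_add h3.summable, h3.tsum_eq, add_mul]
  refine add_le_add (b1.trans_eq ?_) ?_
  · rw [Real.exp_add]; ring
  · rw [div_le_iff₀ (by positivity), Real.sinh_eq, Real.cosh_eq]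
    have := Real.exp_pos (-w)
    have : Real.exp (-w) ≤ Real.exp w := Real.exp_le_exp.mpr (by linarith)
    nlinarith

lemma rpow_le_pow_add_inv {l a : ℝ} {k : ℕ} (hl : 0 < l) (h1 : -1 ≤ a) (h2 : a ≤ k) :
    l ^ a ≤ l ^ k + l⁻¹ := by
  rcases le_total 1 l with h | h
  · have := Real.rpow_le_rpow_of_exponent_le h h2
    rw [Real.rpow_natCast] at this
    have : 0 < l⁻¹ := by positivity
    linarith
  · have := Real.rpow_le_rpow_of_exponent_ge hl h h1
    rw [Real.rpow_neg_one] at this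
    have : 0 < l ^ k := by positivity
    linarith

lemma le_rpow_of_le_one {l a e : ℝ} {k : ℕ} (hl : 0 < l) (hk : k ≠ 0) (he : 0 < e) (he1 : e ≤ 1) :
    e ^ |a| * (1 - e * (l ^ k + l⁻¹)) ≤ l ^ a := by
  have hle : 0 < e ^ |a| := by positivity
  have hlk : 0 < l ^ k := by positivity
  have hli : 0 < l⁻¹ := by positivity
  by_cases h1 : l < e
  · have : 1 < e * l⁻¹ := by rw [← div_eq_mul_inv, one_lt_div hl]; exact h1
    have h3 : 1 - e * (l ^ k + l⁻¹) ≤ 0 := by nlinarith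
    exact (mul_nonpos_of_nonneg_of_nonpos hle.le h3).trans (by positivity)
  by_cases h2 : e⁻¹ < l
  · have h4 : 1 ≤ l := le_trans (one_le_inv₀ he |>.mpr he1) h2.le
    have h5 : l ≤ l ^ k := le_self_pow₀ h4 hk
    have : 1 < e * l := by
      rw [inv_lt_iff_one_lt_mul₀ he] at h2; linarith
    have h3 : 1 - e * (l ^ k + l⁻¹) ≤ 0 := by nlinarith
    exact (mul_nonpos_of_nonneg_of_nonpos hle.le h3).trans (by positivity)
  push Not at h1 h2
  have h3 : e ^ |a| * (1 - e * (l ^ k + l⁻¹)) ≤ e ^ |a| := by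
    have : 0 ≤ e * (l ^ k + l⁻¹) := by positivity
    nlinarith
  refine h3.trans ?_
  rcases le_total 0 a with ha | ha
  · rw [abs_of_nonneg ha]; gcongr
  · rw [abs_of_nonpos ha, Real.rpow_neg he.le, ← Real.inv_rpow he.le]
    exact Real.rpow_le_rpow_of_nonpos hl h2 ha

lemma rpow_neg_succ_eq {w a : ℝ} (hw : 0 < w) (n : ℕ) :
    ((n : ℝ) + 1) ^ (-a) = (1 + w) ^ (-a) * ((1 + w) / (n + 1)) ^ a := by
  rw [Real.div_rpow (by positivity) (by positivity), Real.rpow_neg (by positivity),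
    Real.rpow_neg (by positivity)]
  have : 0 < (1 + w) ^ a := by positivity
  have : 0 < ((n : ℝ) + 1) ^ a := by positivity
  field_simp

lemma exists_besselI_le {μ : ℝ} (hμ : -1 < μ) :
    ∃ C : ℝ, 0 < C ∧ ∀ w : ℝ, 0 < w → Summable (besselTerm μ w) ∧
      besselI μ w ≤ C * (w ^ μ * (1 + w) ^ (-(μ + 1 / 2)) * Real.exp w) := by
  obtain ⟨C, hC, h⟩ := exists_besselTerm_le hμ
  set k : ℕ := ⌈μ + 1 / 2⌉₊
  obtain ⟨C', hC', h'⟩ := exists_tsum_coshTerm_mul_le k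
  refine ⟨C * C', by positivity, fun w hw => ?_⟩
  obtain ⟨s, hs⟩ := h' w hw
  have s1 := s.mul_left (C * w ^ μ * (1 + w) ^ (-(μ + 1 / 2)))
  have hle : ∀ n, besselTerm μ w n ≤ C * w ^ μ * (1 + w) ^ (-(μ + 1 / 2)) *
      (coshTerm w n * (((1 + w) / (n + 1)) ^ k + ((1 + w) / (n + 1))⁻¹)) := by
    intro n
    refine (h w hw n).trans ?_
    rw [rpow_neg_succ_eq hw]
    have := rpow_le_pow_add_inv (l := (1 + w) / (n + 1)) (a := μ + 1 / 2) (k := k)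
      (by positivity) (by linarith) (Nat.le_ceil _)
    have hc := coshTerm_nonneg w n
    calc _ = C * w ^ μ * (1 + w) ^ (-(μ + 1 / 2)) *
          (coshTerm w n * ((1 + w) / (n + 1)) ^ (μ + 1 / 2)) := by unfold coshTerm; ring
      _ ≤ _ := by gcongr
  have s0 := s1.of_nonneg_of_le (besselTerm_nonneg hμ hw) hle
  refine ⟨s0, (s0.tsum_le_tsum hle s1).trans ?_⟩
  rw [tsum_mul_left]
  calc _ ≤ C * w ^ μ * (1 + w) ^ (-(μ + 1 / 2)) * (C' * Real.exp w) := by gcongr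
    _ = _ := by ring

lemma exists_le_besselI {μ : ℝ} (hμ : -1 < μ) :
    ∃ c : ℝ, 0 < c ∧ ∀ w : ℝ, 0 < w →
      c * (w ^ μ * (1 + w) ^ (-(μ + 1 / 2)) * Real.exp w) ≤ besselI μ w := by
  obtain ⟨c, hc, h⟩ := exists_le_besselTerm hμ
  obtain ⟨C', hC', h'⟩ := exists_tsum_coshTerm_mul_le 1
  obtain ⟨_, -, hI⟩ := exists_besselI_le hμ
  set e : ℝ := (1 + 4 * C')⁻¹ with he
  have he0 : 0 < e := by positivity
  have he1 : e ≤ 1 := inv_le_one_of_one_le₀ (by linarith)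
  have heC : e * C' ≤ 1 / 4 := by
    rw [he, inv_mul_le_iff₀ (by positivity)]; linarith
  refine ⟨c * e ^ |μ + 1 / 2| / 4, by positivity, fun w hw => ?_⟩
  obtain ⟨s, hs⟩ := h' w hw
  have hcosh : HasSum (coshTerm w) (Real.cosh w) := Real.hasSum_cosh w
  have s1 := (hcosh.summable.sub (s.mul_left e)).mul_left
    (c * w ^ μ * (1 + w) ^ (-(μ + 1 / 2)) * e ^ |μ + 1 / 2|)
  have hle : ∀ n, c * w ^ μ * (1 + w) ^ (-(μ + 1 / 2)) * e ^ |μ + 1 / 2| * (coshTerm w n -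
      e * (coshTerm w n * (((1 + w) / (n + 1)) ^ 1 + ((1 + w) / (n + 1))⁻¹))) ≤
      besselTerm μ w n := by
    intro n
    refine le_trans ?_ (h w hw n)
    rw [rpow_neg_succ_eq hw]
    have := le_rpow_of_le_one (l := (1 + w) / (n + 1)) (a := μ + 1 / 2) (k := 1)
      (by positivity) one_ne_zero he0 he1
    have hc := coshTerm_nonneg w n
    calc _ = c * w ^ μ * (1 + w) ^ (-(μ + 1 / 2)) * (coshTerm w n * (e ^ |μ + 1 / 2| *
          (1 - e * (((1 + w) / (n + 1)) ^ 1 + ((1 + w) / (n + 1))⁻¹)))) := by ring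
      _ ≤ c * w ^ μ * (1 + w) ^ (-(μ + 1 / 2)) *
          (coshTerm w n * ((1 + w) / (n + 1)) ^ (μ + 1 / 2)) := by gcongr
      _ = _ := by unfold coshTerm; ring
  refine le_trans ?_ (s1.tsum_le_tsum hle (hI w hw).1)
  rw [tsum_mul_left, hcosh.summable.tsum_sub (s.mul_left e), hcosh.tsum_eq, tsum_mul_left]
  have h1 : Real.exp w / 4 ≤ Real.cosh w - e * ∑' n : ℕ,
      coshTerm w n * (((1 + w) / (n + 1)) ^ 1 + ((1 + w) / (n + 1))⁻¹) := by
    have h2 : Real.exp w / 2 ≤ Real.cosh w := by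
      rw [Real.cosh_eq]; have := Real.exp_pos (-w); linarith
    have h3 := mul_le_mul_of_nonneg_left hs he0.le
    have h4 := mul_le_mul_of_nonneg_right heC (Real.exp_pos w).le
    linarith
  calc _ = c * w ^ μ * (1 + w) ^ (-(μ + 1 / 2)) * e ^ |μ + 1 / 2| * (Real.exp w / 4) := by ring
    _ ≤ _ := by gcongr

/-- The density of `W̃_t^ν(x,·) dη_ν` with respect to Lebesgue measure. -/
def exoDensity (ν t x y : ℝ) : ℝ := Wexo ν t x y * y ^ (2 * ν + 1)

/-- An elementary kernel comparable with `exoDensity`, in the time variable `T = 2t`. -/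
def modelKernel (ν T x y : ℝ) : ℝ :=
  T ^ (-(1 / 2) : ℝ) * x ^ (-(2 * ν)) * y * (T + x * y) ^ (ν - 1 / 2) *
    Real.exp (-(x - y) ^ 2 / (2 * T))

lemma modelKernel_eq {ν t x y : ℝ} (ht : 0 < t) (hx : 0 < x) (hy : 0 < y) :
    modelKernel ν (2 * t) x y = (x * y) ^ (-(2 * ν)) * ((2 * t)⁻¹ * (x * y) ^ (-(-ν)) *
      Real.exp (-(x ^ 2 + y ^ 2) / (4 * t)) * ((x * y / (2 * t)) ^ (-ν) *
        (1 + x * y / (2 * t)) ^ (-(-ν + 1 / 2)) * Real.exp (x * y / (2 * t)))) *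
      y ^ (2 * ν + 1) := by
  have hT : 0 < 2 * t := by positivity
  have e1 : Real.exp (-(x - y) ^ 2 / (2 * (2 * t))) =
      Real.exp (-(x ^ 2 + y ^ 2) / (4 * t)) * Real.exp (x * y / (2 * t)) := by
    rw [← Real.exp_add]; congr 1; field_simp; ring
  have e2 : 1 + x * y / (2 * t) = (2 * t + x * y) / (2 * t) := by field_simp
  have e3 : -(-ν + 1 / 2) = ν - 1 / 2 := by ring
  have hs : 0 < 2 * t + x * y := by positivity
  rw [modelKernel, e1, e2, e3, neg_neg, Real.div_rpow hs.le hT.le,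
    Real.div_rpow (by positivity) hT.le, Real.mul_rpow hx.le hy.le, Real.mul_rpow hx.le hy.le,
    Real.mul_rpow hx.le hy.le, Real.rpow_add hy, Real.rpow_one]
  have l1 : x ^ ν * x ^ (-ν) = 1 := by rw [← Real.rpow_add hx]; simp
  have l2 : y ^ (-(2 * ν)) * y ^ (2 * ν) = 1 := by rw [← Real.rpow_add hy]; simp
  have l3 : y ^ ν * y ^ (-ν) = 1 := by rw [← Real.rpow_add hy]; simp
  have l4 : (2 * t)⁻¹ / ((2 * t) ^ (-ν) * (2 * t) ^ (ν - 1 / 2)) =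
      (2 * t) ^ (-(1 / 2) : ℝ) := by
    rw [← Real.rpow_add hT, ← Real.rpow_neg_one, ← Real.rpow_sub hT]; congr 1; ring
  rw [← l4]
  generalize x ^ ν = a at *
  generalize x ^ (-ν) = b at *
  generalize y ^ ν = c at *
  generalize y ^ (-ν) = d at *
  generalize y ^ (2 * ν) = f at *
  generalize y ^ (-(2 * ν)) = g at *
  calc _ = 1 * 1 * 1 * ((2 * t)⁻¹ / ((2 * t) ^ (-ν) * (2 * t) ^ (ν - 1 / 2)) * x ^ (-(2 * ν)) *
        y * (2 * t + x * y) ^ (ν - 1 / 2) * (Real.exp (-(x ^ 2 + y ^ 2) / (4 * t)) *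
          Real.exp (x * y / (2 * t)))) := by ring
    _ = (a * b) * (g * f) * (c * d) * ((2 * t)⁻¹ / ((2 * t) ^ (-ν) * (2 * t) ^ (ν - 1 / 2)) *
        x ^ (-(2 * ν)) *
        y * (2 * t + x * y) ^ (ν - 1 / 2) * (Real.exp (-(x ^ 2 + y ^ 2) / (4 * t)) *
          Real.exp (x * y / (2 * t)))) := by rw [l1, l2, l3]
    _ = _ := by ring

lemma exists_exoDensity_le {ν : ℝ} (hν : ν < 1) :
    ∃ C : ℝ, 0 < C ∧ ∀ t x y : ℝ, 0 < t → 0 < x → 0 < y →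
      exoDensity ν t x y ≤ C * modelKernel ν (2 * t) x y := by
  obtain ⟨C, hC, h⟩ := exists_besselI_le (μ := -ν) (by linarith)
  refine ⟨C, hC, fun t x y ht hx hy => ?_⟩
  have h1 := (h (x * y / (2 * t)) (by positivity)).2
  rw [modelKernel_eq ht hx hy, exoDensity, Wexo, Wcls]
  calc _ ≤ (x * y) ^ (-(2 * ν)) * ((2 * t)⁻¹ * (x * y) ^ (-(-ν)) *
      Real.exp (-(x ^ 2 + y ^ 2) / (4 * t)) * (C * ((x * y / (2 * t)) ^ (-ν) *
        (1 + x * y / (2 * t)) ^ (-(-ν + 1 / 2)) * Real.exp (x * y / (2 * t))))) *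
      y ^ (2 * ν + 1) := by gcongr
    _ = _ := by ring

lemma exists_le_exoDensity {ν : ℝ} (hν : ν < 1) :
    ∃ c : ℝ, 0 < c ∧ ∀ t x y : ℝ, 0 < t → 0 < x → 0 < y →
      c * modelKernel ν (2 * t) x y ≤ exoDensity ν t x y := by
  obtain ⟨c, hc, h⟩ := exists_le_besselI (μ := -ν) (by linarith)
  refine ⟨c, hc, fun t x y ht hx hy => ?_⟩
  have h1 := h (x * y / (2 * t)) (by positivity)
  rw [modelKernel_eq ht hx hy, exoDensity, Wexo, Wcls]
  calc _ = (x * y) ^ (-(2 * ν)) * ((2 * t)⁻¹ * (x * y) ^ (-(-ν)) *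
      Real.exp (-(x ^ 2 + y ^ 2) / (4 * t)) * (c * ((x * y / (2 * t)) ^ (-ν) *
        (1 + x * y / (2 * t)) ^ (-(-ν + 1 / 2)) * Real.exp (x * y / (2 * t))))) *
      y ^ (2 * ν + 1) := by ring
    _ ≤ _ := by gcongr

lemma modelKernel_nonneg {ν T x y : ℝ} (hT : 0 < T) (hx : 0 < x) (hy : 0 < y) :
    0 ≤ modelKernel ν T x y := by
  unfold modelKernel; positivity

lemma exoDensity_nonneg {ν t x y : ℝ} (hν : ν < 1) (ht : 0 < t) (hx : 0 < x) (hy : 0 < y) :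
    0 ≤ exoDensity ν t x y := by
  obtain ⟨c, hc, h⟩ := exists_le_exoDensity hν
  exact le_trans (mul_nonneg hc.le (modelKernel_nonneg (by positivity) hx hy)) (h t x y ht hx hy)

lemma one_add_pow_mul_exp_neg_le {r : ℝ} (hr : 0 ≤ r) (k : ℕ) :
    (1 + r) ^ k * Real.exp (-(r / 8)) ≤ k.factorial * 8 ^ k * Real.exp (1 / 8) := by
  have h := Real.pow_div_factorial_le_exp ((1 + r) / 8) (by positivity) k
  have hf : (0 : ℝ) < k.factorial := by exact_mod_cast k.factorial_pos
  rw [div_le_iff₀ hf, div_pow, div_le_iff₀ (by positivity)] at h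
  calc _ ≤ Real.exp ((1 + r) / 8) * k.factorial * 8 ^ k * Real.exp (-(r / 8)) := by gcongr
    _ = k.factorial * 8 ^ k * (Real.exp ((1 + r) / 8) * Real.exp (-(r / 8))) := by ring
    _ = _ := by rw [← Real.exp_add]; congr 2; ring

lemma exists_gaussian_factor_le {ν : ℝ} (hν : ν < 1) :
    ∃ C : ℝ, 0 < C ∧ ∀ T z q : ℝ, 0 < T → 0 < z → 0 ≤ q → q ≤ z ^ 2 →
      T ^ (-(1 / 2) : ℝ) * z ^ (2 - 2 * ν) * (T + q) ^ (ν - 1 / 2) *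
        Real.exp (-(z ^ 2 / T / 8)) ≤ C := by
  set k : ℕ := ⌈(1 - ν) + 1⌉₊ with hk
  refine ⟨k.factorial * 8 ^ k * Real.exp (1 / 8), by positivity, fun T z q hT hz hq hqz => ?_⟩
  have hr : 0 < z ^ 2 / T := by positivity
  refine le_trans ?_ (one_add_pow_mul_exp_neg_le hr.le k)
  gcongr
  have e1 : z ^ (2 - 2 * ν) = (z ^ 2 / T) ^ (1 - ν) * T ^ (1 - ν) := by
    rw [← Real.mul_rpow hr.le hT.le, div_mul_cancel₀ _ hT.ne', ← Real.rpow_natCast,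
      ← Real.rpow_mul hz.le]
    congr 1; push_cast; ring
  have e2 : (T + q) ^ (ν - 1 / 2) = T ^ (ν - 1 / 2) * (1 + q / T) ^ (ν - 1 / 2) := by
    rw [← Real.mul_rpow hT.le (by positivity)]; congr 1; field_simp
  have e3 : T ^ (-(1 / 2) : ℝ) * T ^ (1 - ν) * T ^ (ν - 1 / 2) = 1 := by
    rw [← Real.rpow_add hT, ← Real.rpow_add hT]
    convert! Real.rpow_zero T using 2; ring
  have h1 : (1 + q / T) ^ (ν - 1 / 2) ≤ 1 + z ^ 2 / T := by
    calc (1 + q / T) ^ (ν - 1 / 2) ≤ (1 + q / T) ^ (1 : ℝ) :=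
          Real.rpow_le_rpow_of_exponent_le (by have : 0 ≤ q / T := by positivity
                                               linarith) (by linarith)
      _ ≤ _ := by rw [Real.rpow_one]; gcongr
  have h2 : (z ^ 2 / T) ^ (1 - ν) ≤ (1 + z ^ 2 / T) ^ (1 - ν) :=
    Real.rpow_le_rpow hr.le (by linarith) (by linarith)
  calc _ = (T ^ (-(1 / 2) : ℝ) * T ^ (1 - ν) * T ^ (ν - 1 / 2)) *
        ((z ^ 2 / T) ^ (1 - ν) * (1 + q / T) ^ (ν - 1 / 2)) := by rw [e1, e2]; ring
    _ ≤ (1 + z ^ 2 / T) ^ (1 - ν) * (1 + z ^ 2 / T) := by rw [e3, one_mul]; gcongr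
    _ = (1 + z ^ 2 / T) ^ (1 - ν + 1) := by rw [Real.rpow_add (by positivity), Real.rpow_one]
    _ ≤ (1 + z ^ 2 / T) ^ (k : ℝ) :=
        Real.rpow_le_rpow_of_exponent_le (by linarith) (Nat.le_ceil _)
    _ = _ := Real.rpow_natCast _ _

lemma exists_modelKernel_le_of_le {ν : ℝ} (hν : ν < 1) :
    ∃ C : ℝ, 0 < C ∧ ∀ T x y : ℝ, 0 < T → 0 < x → 0 < y → 2 * y ≤ x →
      modelKernel ν T x y ≤ C * (x ^ (-2 : ℝ) * y) := by
  obtain ⟨C, hC, h⟩ := exists_gaussian_factor_le hν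
  refine ⟨C, hC, fun T x y hT hx hy hxy => ?_⟩
  have h1 := h T x (x * y) hT hx (by positivity) (by nlinarith)
  have h2 : Real.exp (-(x - y) ^ 2 / (2 * T)) ≤ Real.exp (-(x ^ 2 / T / 8)) := by
    rw [Real.exp_le_exp, neg_div, neg_le_neg_iff, div_div, div_le_div_iff₀ (by positivity)
      (by positivity)]
    nlinarith [mul_nonneg hT.le (mul_nonneg (by linarith : (0:ℝ) ≤ x - 2 * y)
      (by linarith : (0:ℝ) ≤ 3 * x - 2 * y))]
  have e : x ^ (-(2 * ν)) = x ^ (-2 : ℝ) * x ^ (2 - 2 * ν) := by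
    rw [← Real.rpow_add hx]; congr 1; ring
  rw [modelKernel, e]
  calc _ ≤ T ^ (-(1 / 2) : ℝ) * (x ^ (-2 : ℝ) * x ^ (2 - 2 * ν)) * y *
        (T + x * y) ^ (ν - 1 / 2) * Real.exp (-(x ^ 2 / T / 8)) := by gcongr
    _ = (T ^ (-(1 / 2) : ℝ) * x ^ (2 - 2 * ν) * (T + x * y) ^ (ν - 1 / 2) *
        Real.exp (-(x ^ 2 / T / 8))) * (x ^ (-2 : ℝ) * y) := by ring
    _ ≤ _ := by gcongr

lemma exists_modelKernel_le_of_ge {ν : ℝ} (hν : ν < 1) :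
    ∃ C : ℝ, 0 < C ∧ ∀ T x y : ℝ, 0 < T → 0 < x → 0 < y → 2 * x ≤ y →
      modelKernel ν T x y ≤ C * (x ^ (-(2 * ν)) * y ^ (2 * ν - 1)) := by
  obtain ⟨C, hC, h⟩ := exists_gaussian_factor_le hν
  refine ⟨C, hC, fun T x y hT hx hy hxy => ?_⟩
  have h1 := h T y (x * y) hT hy (by positivity) (by nlinarith)
  have h2 : Real.exp (-(x - y) ^ 2 / (2 * T)) ≤ Real.exp (-(y ^ 2 / T / 8)) := by
    rw [Real.exp_le_exp, neg_div, neg_le_neg_iff, div_div, div_le_div_iff₀ (by positivity)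
      (by positivity)]
    nlinarith [mul_nonneg hT.le (mul_nonneg (by linarith : (0:ℝ) ≤ y - 2 * x)
      (by linarith : (0:ℝ) ≤ 3 * y - 2 * x))]
  have e : y = y ^ (2 * ν - 1) * y ^ (2 - 2 * ν) := by
    rw [← Real.rpow_add hy]
    conv_lhs => rw [← Real.rpow_one y]
    congr 1; ring
  rw [modelKernel]
  calc _ ≤ T ^ (-(1 / 2) : ℝ) * x ^ (-(2 * ν)) * y *
        (T + x * y) ^ (ν - 1 / 2) * Real.exp (-(y ^ 2 / T / 8)) := by gcongr
    _ = T ^ (-(1 / 2) : ℝ) * x ^ (-(2 * ν)) * (y ^ (2 * ν - 1) * y ^ (2 - 2 * ν)) *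
        (T + x * y) ^ (ν - 1 / 2) * Real.exp (-(y ^ 2 / T / 8)) := by rw [← e]
    _ = (T ^ (-(1 / 2) : ℝ) * y ^ (2 - 2 * ν) * (T + x * y) ^ (ν - 1 / 2) *
        Real.exp (-(y ^ 2 / T / 8))) * (x ^ (-(2 * ν)) * y ^ (2 * ν - 1)) := by ring
    _ ≤ _ := by gcongr

lemma exists_modelKernel_le_local {ν : ℝ} (hν : ν < 1) :
    ∃ C : ℝ, 0 < C ∧ ∀ T x y : ℝ, 0 < T → 0 < x → 0 < y → x ≤ 2 * y → y ≤ 2 * x →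
      modelKernel ν T x y ≤
        C * (T ^ (-(1 / 2) : ℝ) * Real.exp (-(x - y) ^ 2 / (2 * T)) + x⁻¹) := by
  refine ⟨2 * 2 ^ (1 / 2 - ν) + 6, by positivity, fun T x y hT hx hy hxy hyx => ?_⟩
  have hE : 0 < Real.exp (-(x - y) ^ 2 / (2 * T)) := Real.exp_pos _
  have hE1 : Real.exp (-(x - y) ^ 2 / (2 * T)) ≤ 1 := by
    rw [Real.exp_le_one_iff, neg_div, neg_nonpos]; positivity
  have hTp : 0 < T ^ (-(1 / 2) : ℝ) := by positivity
  have hG : 0 < T ^ (-(1 / 2) : ℝ) * Real.exp (-(x - y) ^ 2 / (2 * T)) := by positivity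
  have hxi : 0 < x⁻¹ := by positivity
  have h2 : (0 : ℝ) < 2 ^ (1 / 2 - ν) := by positivity
  have ex : x ^ (-(2 * ν)) * x * (x ^ 2) ^ (ν - 1 / 2) = 1 := by
    rw [← Real.rpow_natCast, ← Real.rpow_mul hx.le]
    nth_rw 2 [← Real.rpow_one x]
    rw [← Real.rpow_add hx, ← Real.rpow_add hx]
    convert! Real.rpow_zero x using 2; push_cast; ring
  have main : ∀ D : ℝ, 0 < D → D ≤ 2 * 2 ^ (1 / 2 - ν) + 6 →
      2 * (T + x * y) ^ (ν - 1 / 2) ≤ D * (x ^ 2) ^ (ν - 1 / 2) →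
      modelKernel ν T x y ≤ (2 * 2 ^ (1 / 2 - ν) + 6) *
        (T ^ (-(1 / 2) : ℝ) * Real.exp (-(x - y) ^ 2 / (2 * T)) + x⁻¹) := by
    intro D hD hDle h
    calc modelKernel ν T x y ≤ T ^ (-(1 / 2) : ℝ) * x ^ (-(2 * ν)) * (2 * x) *
          (T + x * y) ^ (ν - 1 / 2) * Real.exp (-(x - y) ^ 2 / (2 * T)) := by
          unfold modelKernel; gcongr
      _ = T ^ (-(1 / 2) : ℝ) * x ^ (-(2 * ν)) * x *
          (2 * (T + x * y) ^ (ν - 1 / 2)) * Real.exp (-(x - y) ^ 2 / (2 * T)) := by ring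
      _ ≤ T ^ (-(1 / 2) : ℝ) * x ^ (-(2 * ν)) * x *
          (D * (x ^ 2) ^ (ν - 1 / 2)) * Real.exp (-(x - y) ^ 2 / (2 * T)) := by gcongr
      _ = D * (T ^ (-(1 / 2) : ℝ) * Real.exp (-(x - y) ^ 2 / (2 * T))) *
          (x ^ (-(2 * ν)) * x * (x ^ 2) ^ (ν - 1 / 2)) := by ring
      _ ≤ _ := by rw [ex, mul_one]; gcongr; linarith
  rcases le_total ν (1 / 2) with hn | hn
  · refine main (2 * 2 ^ (1 / 2 - ν)) (by positivity) (by linarith) ?_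
    have : (T + x * y) ^ (ν - 1 / 2) ≤ (x ^ 2 / 2) ^ (ν - 1 / 2) :=
      Real.rpow_le_rpow_of_nonpos (by positivity) (by nlinarith) (by linarith)
    refine (mul_le_mul_of_nonneg_left this zero_le_two).trans_eq ?_
    rw [Real.div_rpow (by positivity) (by norm_num), show ν - 1 / 2 = -(1 / 2 - ν) by ring,
      Real.rpow_neg (x := 2) (by norm_num)]
    field_simp
  rcases le_total T (x ^ 2) with hTx | hTx
  · refine main 6 (by norm_num) (by linarith) ?_
    have h3 : (T + x * y) ^ (ν - 1 / 2) ≤ (3 * x ^ 2) ^ (ν - 1 / 2) :=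
      Real.rpow_le_rpow (by positivity) (by nlinarith) (by linarith)
    have h4 : (3 : ℝ) ^ (ν - 1 / 2) ≤ 3 := by
      conv_rhs => rw [← Real.rpow_one 3]
      exact Real.rpow_le_rpow_of_exponent_le (by norm_num) (by linarith)
    rw [Real.mul_rpow (by norm_num) (by positivity)] at h3
    have : 0 < (x ^ 2) ^ (ν - 1 / 2) := by positivity
    nlinarith
  · have h3 : (T + x * y) ^ (ν - 1 / 2) ≤ (3 * T) ^ (ν - 1 / 2) :=
      Real.rpow_le_rpow (by positivity) (by nlinarith) (by linarith)
    have h4 : (3 * T) ^ (ν - 1 / 2) ≤ 3 * T ^ (1 / 2 : ℝ) * (x ^ 2) ^ (ν - 1) := by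
      rw [show ν - 1 / 2 = 1 / 2 + (ν - 1) by ring, Real.rpow_add (by positivity),
        Real.mul_rpow (by norm_num) hT.le]
      have h5 : (3 * T) ^ (ν - 1) ≤ (x ^ 2) ^ (ν - 1) :=
        Real.rpow_le_rpow_of_nonpos (by positivity) (by linarith) (by linarith)
      have h6 : (3 : ℝ) ^ (1 / 2 : ℝ) ≤ 3 := by
        conv_rhs => rw [← Real.rpow_one 3]
        exact Real.rpow_le_rpow_of_exponent_le (by norm_num) (by norm_num)
      gcongr
    have e1 : T ^ (-(1 / 2) : ℝ) * T ^ (1 / 2 : ℝ) = 1 := by rw [← Real.rpow_add hT]; simp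
    have e2 : x ^ (-(2 * ν)) * x * (x ^ 2) ^ (ν - 1) = x⁻¹ := by
      rw [← Real.rpow_natCast, ← Real.rpow_mul hx.le, ← Real.rpow_neg_one]
      nth_rw 2 [← Real.rpow_one x]
      rw [← Real.rpow_add hx, ← Real.rpow_add hx]
      congr 1; push_cast; ring
    calc modelKernel ν T x y ≤ T ^ (-(1 / 2) : ℝ) * x ^ (-(2 * ν)) * (2 * x) *
          (3 * T ^ (1 / 2 : ℝ) * (x ^ 2) ^ (ν - 1)) * 1 := by
          unfold modelKernel; gcongr; exact h3.trans h4
      _ = 6 * (T ^ (-(1 / 2) : ℝ) * T ^ (1 / 2 : ℝ)) *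
          (x ^ (-(2 * ν)) * x * (x ^ 2) ^ (ν - 1)) := by ring
      _ = 6 * x⁻¹ := by rw [e1, e2]; ring
      _ ≤ _ := by gcongr <;> linarith

/-- The centered Hardy–Littlewood maximal function on the real line. -/
def hlMax (g : ℝ → ℝ≥0∞) (x : ℝ) : ℝ≥0∞ :=
  ⨆ r ∈ Ioi (0 : ℝ), (ENNReal.ofReal (2 * r))⁻¹ * ∫⁻ y in Metric.closedBall x r, g y

lemma lintegral_closedBall_le_mul_hlMax (g : ℝ → ℝ≥0∞) (x : ℝ) {r : ℝ} (hr : 0 < r) :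
    ∫⁻ y in Metric.closedBall x r, g y ≤ ENNReal.ofReal (2 * r) * hlMax g x := by
  have h0 : ENNReal.ofReal (2 * r) ≠ 0 := by simpa using hr
  have h1 : (ENNReal.ofReal (2 * r))⁻¹ * ∫⁻ y in Metric.closedBall x r, g y ≤ hlMax g x :=
    le_iSup₂ (f := fun r (_ : r ∈ Ioi (0 : ℝ)) =>
      (ENNReal.ofReal (2 * r))⁻¹ * ∫⁻ y in Metric.closedBall x r, g y) r hr
  rwa [mul_comm, ← div_eq_mul_inv, ENNReal.div_le_iff' h0 ofReal_ne_top] at h1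

lemma hlMax_const_le (c : ℝ≥0∞) (x : ℝ) : hlMax (fun _ => c) x ≤ c := by
  refine iSup₂_le fun r hr => ?_
  have h0 : ENNReal.ofReal (2 * r) ≠ 0 := by simpa using hr
  rw [setLIntegral_const, Real.volume_closedBall, mul_comm c, ← mul_assoc,
    ENNReal.inv_mul_cancel h0 ofReal_ne_top, one_mul]

lemma hlMax_add_le {g h : ℝ → ℝ≥0∞} (hg : Measurable g) (x : ℝ) :
    hlMax (fun y => g y + h y) x ≤ hlMax g x + hlMax h x := by
  refine iSup₂_le fun r hr => ?_
  rw [lintegral_add_left hg, mul_add]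
  gcongr
  · exact le_iSup₂ (f := fun r (_ : r ∈ Ioi (0 : ℝ)) =>
      (ENNReal.ofReal (2 * r))⁻¹ * ∫⁻ y in Metric.closedBall x r, g y) r hr
  · exact le_iSup₂ (f := fun r (_ : r ∈ Ioi (0 : ℝ)) =>
      (ENNReal.ofReal (2 * r))⁻¹ * ∫⁻ y in Metric.closedBall x r, h y) r hr

lemma hlMax_mono {g h : ℝ → ℝ≥0∞} (hgh : ∀ y, g y ≤ h y) (x : ℝ) : hlMax g x ≤ hlMax h x := by
  unfold hlMax
  gcongr with r hr
  exact hgh _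

open Filter Topology in
lemma isOpen_lt_hlMax (g : ℝ → ℝ≥0∞) (c : ℝ≥0∞) : IsOpen {x | c < hlMax g x} := by
  rw [Metric.isOpen_iff]
  intro x hx
  obtain ⟨r, hx⟩ := lt_iSup_iff.mp (show c < hlMax g x from hx)
  obtain ⟨hr, hx⟩ := lt_iSup_iff.mp hx
  have hr : 0 < r := hr
  have hcont : Tendsto (fun s : ℝ => (ENNReal.ofReal (2 * s))⁻¹ *
      ∫⁻ y in Metric.closedBall x r, g y) (𝓝[>] r)
      (𝓝 ((ENNReal.ofReal (2 * r))⁻¹ * ∫⁻ y in Metric.closedBall x r, g y)) := by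
    refine ENNReal.Tendsto.mul_const ?_ (Or.inl (ENNReal.inv_ne_zero.mpr ofReal_ne_top))
    refine tendsto_nhdsWithin_of_tendsto_nhds ?_
    have : Continuous fun s : ℝ => (ENNReal.ofReal (2 * s))⁻¹ :=
      (ENNReal.continuous_ofReal.comp (by fun_prop : Continuous fun s : ℝ => 2 * s)).inv
    exact this.tendsto r
  obtain ⟨s, hs, hrs⟩ := ((hcont.eventually_const_lt hx).and self_mem_nhdsWithin).exists
  have hrs : r < s := hrs
  refine ⟨s - r, by linarith, fun x' hx' => ?_⟩
  refine lt_of_lt_of_le hs ?_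
  refine le_trans ?_ (le_iSup₂ (f := fun r (_ : r ∈ Ioi (0 : ℝ)) =>
      (ENNReal.ofReal (2 * r))⁻¹ * ∫⁻ y in Metric.closedBall x' r, g y) s (hr.trans hrs))
  gcongr
  refine Metric.closedBall_subset_closedBall' ?_
  rw [dist_comm]
  have := Metric.mem_ball.mp hx'
  linarith

lemma measurable_hlMax (g : ℝ → ℝ≥0∞) : Measurable (hlMax g) :=
  measurable_of_Ioi fun c => (isOpen_lt_hlMax g c).measurableSet

/-- The weak type `(1,1)` inequality for the Hardy–Littlewood maximal function. -/
lemma mul_volume_lt_hlMax_le (g : ℝ → ℝ≥0∞) {l : ℝ} (hl : 0 < l) :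
    ENNReal.ofReal l * volume {x | ENNReal.ofReal l < hlMax g x} ≤ 5 * ∫⁻ y, g y := by
  by_cases hfin : ∫⁻ y, g y = ⊤
  · simp [hfin]
  have hl0 : ENNReal.ofReal l ≠ 0 := by simpa using hl
  set S := {x | ENNReal.ofReal l < hlMax g x} with hS
  have key : ∀ x : ℝ, ∃ r : ℝ, x ∈ S → 0 < r ∧
      ENNReal.ofReal l * ENNReal.ofReal (2 * r) ≤ ∫⁻ y in Metric.closedBall x r, g y := by
    intro x
    by_cases hx : x ∈ S
    · obtain ⟨r, hx⟩ := lt_iSup_iff.mp (show ENNReal.ofReal l < hlMax g x from hx)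
      obtain ⟨hr, hx⟩ := lt_iSup_iff.mp hx
      have h0 : ENNReal.ofReal (2 * r) ≠ 0 := by simpa using hr
      refine ⟨r, fun _ => ⟨hr, ?_⟩⟩
      have := hx.le
      rwa [mul_comm _ (lintegral _ _), ← div_eq_mul_inv,
        ENNReal.le_div_iff_mul_le (Or.inl h0) (Or.inl ofReal_ne_top)] at this
    · exact ⟨0, fun h => absurd h hx⟩
  choose r hr using key
  have hR : ∀ a ∈ S, r a ≤ (∫⁻ y, g y).toReal / (2 * l) := by
    intro a ha
    have h1 := (hr a ha).2.trans (setLIntegral_le_lintegral _ _)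
    rw [← ENNReal.ofReal_mul hl.le, ENNReal.ofReal_le_iff_le_toReal hfin] at h1
    rw [le_div_iff₀ (by positivity)]
    linarith
  obtain ⟨u, huS, hdisj, hcov⟩ := Vitali.exists_disjoint_subfamily_covering_enlargement_closedBall
    S id r _ hR 5 (by norm_num)
  have hcount : u.Countable := by
    refine hdisj.countable_of_nonempty_interior fun a ha => ?_
    refine ⟨a, Metric.ball_subset_interior_closedBall (Metric.mem_ball_self (hr a (huS ha)).1)⟩
  have hsub : S ⊆ ⋃ b ∈ u, Metric.closedBall b (5 * r b) := by
    intro a ha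
    obtain ⟨b, hb, hab⟩ := hcov a ha
    exact mem_biUnion hb (hab (Metric.mem_closedBall_self (hr a ha).1.le))
  have := hcount.to_subtype
  calc ENNReal.ofReal l * volume S
      ≤ ENNReal.ofReal l * ∑' b : u, volume (Metric.closedBall (b : ℝ) (5 * r b)) := by
        gcongr
        exact (measure_mono hsub).trans (measure_biUnion_le _ hcount _)
    _ = 5 * ∑' b : u, ENNReal.ofReal l * ENNReal.ofReal (2 * r b) := by
        rw [← ENNReal.tsum_mul_left, ← ENNReal.tsum_mul_left]
        congr 1 with b
        rw [Real.volume_closedBall, show 2 * (5 * r b) = 5 * (2 * r b) by ring,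
          ENNReal.ofReal_mul (by norm_num), ENNReal.ofReal_ofNat]
        ring
    _ ≤ 5 * ∑' b : u, ∫⁻ y in Metric.closedBall (b : ℝ) (r b), g y := by
        gcongr with b
        exact (hr b (huS b.2)).2
    _ = 5 * ∫⁻ y in ⋃ b ∈ u, Metric.closedBall b (r b), g y := by
        rw [lintegral_biUnion (t := u) (s := fun b => Metric.closedBall b (r b)) hcount
          (fun b _ => measurableSet_closedBall) hdisj]
    _ ≤ _ := by exact mul_le_mul_right (setLIntegral_le_lintegral _ _) _

lemma mul_volume_lt_hlMax_le_indicator {g : ℝ → ℝ≥0∞} (hg : Measurable g) {l : ℝ} (hl : 0 < l) :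
    ENNReal.ofReal l * volume {x | ENNReal.ofReal l < hlMax g x} ≤
      10 * ∫⁻ y, {z | ENNReal.ofReal (l / 2) < g z}.indicator g y := by
  set g' := {z | ENNReal.ofReal (l / 2) < g z}.indicator g with hg'
  have hm : Measurable g' := hg.indicator (measurableSet_lt measurable_const hg)
  have hle : ∀ y, g y ≤ g' y + ENNReal.ofReal (l / 2) := by
    intro y
    by_cases hy : ENNReal.ofReal (l / 2) < g y
    · have hmem : y ∈ {z | ENNReal.ofReal (l / 2) < g z} := hy
      rw [hg', indicator_of_mem hmem]
      exact le_self_add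
    · exact le_add_left (not_lt.mp hy)
  have hsub : {x | ENNReal.ofReal l < hlMax g x} ⊆
      {x | ENNReal.ofReal (l / 2) < hlMax g' x} := by
    intro x hx
    by_contra hcon
    have h1 : hlMax g' x ≤ ENNReal.ofReal (l / 2) := not_lt.mp hcon
    have h2 : hlMax g x ≤ ENNReal.ofReal (l / 2) + ENNReal.ofReal (l / 2) :=
      (hlMax_mono hle x).trans <| (hlMax_add_le hm x).trans (add_le_add h1 (hlMax_const_le _ x))
    rw [← ENNReal.ofReal_add (by positivity) (by positivity), add_halves] at h2
    exact absurd (show ENNReal.ofReal l < hlMax g x from hx) (not_lt.mpr h2)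
  have h3 := mul_volume_lt_hlMax_le g' (half_pos hl)
  have h4 : ENNReal.ofReal l = 2 * ENNReal.ofReal (l / 2) := by
    rw [← ENNReal.ofReal_ofNat, ← ENNReal.ofReal_mul (by norm_num)]; congr 1; ring
  calc _ ≤ 2 * (ENNReal.ofReal (l / 2) * volume {x | ENNReal.ofReal (l / 2) < hlMax g' x}) := by
        rw [← mul_assoc, ← h4]
        exact mul_le_mul_right (measure_mono hsub) _
    _ ≤ 2 * (5 * ∫⁻ y, g' y) := by gcongr
    _ = _ := by rw [← mul_assoc]; norm_num

lemma lintegral_Ioo_rpow {s a : ℝ} (hs : -1 < s) (ha : 0 ≤ a) :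
    ∫⁻ l in Ioo 0 a, ENNReal.ofReal (l ^ s) = ENNReal.ofReal (a ^ (s + 1) / (s + 1)) := by
  have hInteg : IntegrableOn (fun l : ℝ => l ^ s) (Ioc 0 a) := by
    rw [← intervalIntegrable_iff_integrableOn_Ioc_of_le ha]
    exact intervalIntegral.intervalIntegrable_rpow' hs
  rw [setLIntegral_congr Ioo_ae_eq_Ioc, ← ofReal_integral_eq_lintegral_ofReal hInteg
    (ae_restrict_of_forall_mem measurableSet_Ioc fun l hl => Real.rpow_nonneg hl.1.le _),
    ← intervalIntegral.integral_of_le ha, integral_rpow (Or.inl hs),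
    Real.zero_rpow (by linarith), sub_zero]

/-- The layer cake formula for a single nonnegative extended real number. -/
lemma lintegral_indicator_lt_rpow {s : ℝ} (hs : 0 < s) (a : ℝ≥0∞) :
    ∫⁻ l in Ioi (0 : ℝ), {l : ℝ | ENNReal.ofReal l < a}.indicator
      (fun l => ENNReal.ofReal (s * l ^ (s - 1))) l = a ^ s := by
  have hfin : ∀ b : ℝ, 0 ≤ b → ∫⁻ l in Ioi (0 : ℝ), {l : ℝ | ENNReal.ofReal l <
      ENNReal.ofReal b}.indicator (fun l => ENNReal.ofReal (s * l ^ (s - 1))) l =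
      ENNReal.ofReal b ^ s := by
    intro b hb
    have e : Ioi (0 : ℝ) ∩ {l : ℝ | ENNReal.ofReal l < ENNReal.ofReal b} = Ioo 0 b := by
      ext l
      simp only [mem_inter_iff, mem_Ioi, Set.mem_ofPred_eq, mem_Ioo]
      refine and_congr_right fun hl => ?_
      exact ENNReal.ofReal_lt_ofReal_iff_of_nonneg hl.le
    rw [setLIntegral_indicator (measurableSet_lt (by fun_prop) measurable_const), inter_comm, e]
    simp_rw [ENNReal.ofReal_mul hs.le]
    rw [lintegral_const_mul' _ _ ofReal_ne_top, lintegral_Ioo_rpow (by linarith) hb,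
      ← ENNReal.ofReal_mul hs.le, ENNReal.ofReal_rpow_of_nonneg hb hs.le, sub_add_cancel]
    congr 1; field_simp
  by_cases ha : a = ⊤
  · rw [ha, ENNReal.top_rpow_of_pos hs]
    refine ENNReal.eq_top_of_forall_nnreal_le fun q => ?_
    have h1 := hfin ((q : ℝ) ^ (1 / s)) (by positivity)
    rw [ENNReal.ofReal_rpow_of_nonneg (by positivity) hs.le, ← Real.rpow_mul q.coe_nonneg,
      one_div_mul_cancel hs.ne', Real.rpow_one, ENNReal.ofReal_coe_nnreal] at h1
    rw [← h1]
    refine lintegral_mono fun l => indicator_le_indicator_of_subset ?_ (fun _ => zero_le) l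
    intro l hl
    exact ofReal_lt_top
  · rw [← ENNReal.ofReal_toReal ha]
    exact hfin _ toReal_nonneg

/-- The strong type `(p,p)` inequality for the Hardy–Littlewood maximal function. -/
lemma exists_lintegral_hlMax_rpow_le {p : ℝ} (hp : 1 < p) :
    ∃ C : ℝ≥0, ∀ g : ℝ → ℝ≥0∞, Measurable g →
      ∫⁻ x, hlMax g x ^ p ≤ C * ∫⁻ x, g x ^ p := by
  have hp0 : 0 < p := by linarith
  have hp1 : 0 < p - 1 := by linarith
  have h2 : (2 : ℝ≥0∞) ^ (p - 1) ≠ ⊤ := ENNReal.rpow_ne_top_of_nonneg hp1.le (by simp)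
  refine ⟨(10 * ENNReal.ofReal (p / (p - 1)) * 2 ^ (p - 1)).toNNReal, fun g hg => ?_⟩
  have hM := measurable_hlMax g
  set w : ℝ → ℝ≥0∞ := fun l => ENNReal.ofReal (p * l ^ (p - 1)) with hw
  have hwm : Measurable w := by fun_prop
  have step1 : ∫⁻ x, hlMax g x ^ p =
      ∫⁻ l in Ioi (0 : ℝ), w l * volume {x | ENNReal.ofReal l < hlMax g x} := by
    simp_rw [← lintegral_indicator_lt_rpow hp0]
    rw [lintegral_lintegral_swap]
    · refine lintegral_congr fun l => ?_
      rw [← lintegral_indicator_const (measurableSet_lt measurable_const hM)]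
      rfl
    · refine Measurable.aemeasurable ?_
      have hms : MeasurableSet {z : ℝ × ℝ | ENNReal.ofReal z.2 < hlMax g z.1} :=
        measurableSet_lt (by fun_prop) (hM.comp measurable_fst)
      exact (hwm.comp measurable_snd).indicator hms
  have step2 : ∀ l ∈ Ioi (0 : ℝ), w l * volume {x | ENNReal.ofReal l < hlMax g x} ≤
      ∫⁻ y, 10 * ENNReal.ofReal (p / (p - 1)) * (g y * {l : ℝ | ENNReal.ofReal l < 2 * g y}.indicator
        (fun l => ENNReal.ofReal ((p - 1) * l ^ (p - 1 - 1))) l) := by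
    intro l hl
    have hl : 0 < l := hl
    have h1 := mul_volume_lt_hlMax_le_indicator hg hl
    have ew : w l = ENNReal.ofReal (p / (p - 1)) *
        ENNReal.ofReal ((p - 1) * l ^ (p - 1 - 1)) * ENNReal.ofReal l := by
      rw [← ENNReal.ofReal_mul (by positivity), ← ENNReal.ofReal_mul (by positivity), hw]
      rw [Real.rpow_sub_one hl.ne' (p - 1)]
      field_simp
    rw [ew, mul_assoc _ (ENNReal.ofReal l)]
    refine (mul_le_mul_right h1 _).trans_eq ?_
    rw [lintegral_const_mul' _ _ (by finiteness)]
    have e2 : ∀ y, g y * {l : ℝ | ENNReal.ofReal l < 2 * g y}.indicator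
        (fun l => ENNReal.ofReal ((p - 1) * l ^ (p - 1 - 1))) l =
        ENNReal.ofReal ((p - 1) * l ^ (p - 1 - 1)) *
          {z | ENNReal.ofReal (l / 2) < g z}.indicator g y := by
      intro y
      have hiff : ENNReal.ofReal l < 2 * g y ↔ ENNReal.ofReal (l / 2) < g y := by
        rw [ENNReal.ofReal_div_of_pos (by norm_num), ENNReal.ofReal_ofNat,
          ENNReal.div_lt_iff (Or.inl (by norm_num)) (Or.inl (by norm_num)), mul_comm]
      by_cases hy : ENNReal.ofReal (l / 2) < g y
      · rw [indicator_of_mem (show l ∈ {l : ℝ | ENNReal.ofReal l < 2 * g y} from hiff.mpr hy),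
          indicator_of_mem (show y ∈ {z | ENNReal.ofReal (l / 2) < g z} from hy), mul_comm]
      · have hl' : l ∉ {l : ℝ | ENNReal.ofReal l < 2 * g y} := fun h => hy (hiff.mp h)
        have hy' : y ∉ {z | ENNReal.ofReal (l / 2) < g z} := hy
        rw [indicator_of_notMem hl', indicator_of_notMem hy']
        simp
    simp_rw [e2]
    rw [lintegral_const_mul' _ _ ofReal_ne_top]
    ring
  rw [step1]
  refine (setLIntegral_mono' measurableSet_Ioi step2).trans ?_
  rw [lintegral_lintegral_swap]
  · have e3 : ∀ y, ∫⁻ l in Ioi (0 : ℝ), 10 * ENNReal.ofReal (p / (p - 1)) *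
        (g y * {l : ℝ | ENNReal.ofReal l < 2 * g y}.indicator
        (fun l => ENNReal.ofReal ((p - 1) * l ^ (p - 1 - 1))) l) =
        10 * ENNReal.ofReal (p / (p - 1)) * 2 ^ (p - 1) * g y ^ p := by
      intro y
      have hmi : Measurable ({l : ℝ | ENNReal.ofReal l < 2 * g y}.indicator
        (fun l => ENNReal.ofReal ((p - 1) * l ^ (p - 1 - 1)))) :=
        Measurable.indicator (by fun_prop) (measurableSet_lt (by fun_prop) measurable_const)
      rw [lintegral_const_mul _ (hmi.const_mul _), lintegral_const_mul _ hmi,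
        lintegral_indicator_lt_rpow hp1, ENNReal.mul_rpow_of_nonneg _ _ hp1.le]
      have : g y ^ p = g y * g y ^ (p - 1) := by
        conv_lhs => rw [show p = 1 + (p - 1) by ring,
          ENNReal.rpow_add_of_nonneg _ _ zero_le_one hp1.le, ENNReal.rpow_one]
      rw [this]; ring
    simp_rw [e3]
    rw [lintegral_const_mul' _ _ (by finiteness)]
    rw [ENNReal.coe_toNNReal (by finiteness)]
  · refine Measurable.aemeasurable ?_
    have hms : MeasurableSet {z : ℝ × ℝ | ENNReal.ofReal z.1 < 2 * g z.2} :=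
      measurableSet_lt (by fun_prop) ((hg.comp measurable_snd).const_mul 2)
    have h1 : Measurable (fun z : ℝ × ℝ => ENNReal.ofReal ((p - 1) * z.1 ^ (p - 1 - 1))) := by
      fun_prop
    exact ((hg.comp measurable_snd).mul (h1.indicator hms)).const_mul _

lemma exists_lintegral_gaussian_mul_le :
    ∃ C : ℝ≥0, ∀ (g : ℝ → ℝ≥0∞) (T x : ℝ), Measurable g → 0 < T →
      ∫⁻ y, ENNReal.ofReal (T ^ (-(1 / 2) : ℝ) * Real.exp (-(x - y) ^ 2 / (2 * T))) * g y ≤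
        C * hlMax g x := by
  set a : ℕ → ℝ := fun j => 2 * (j + 1) * Real.exp (-(1 / 2) * j) with ha
  have hs : Summable a := by
    have h1 := Real.summable_pow_mul_exp_neg_nat_mul 1 (r := 1 / 2) (by norm_num)
    have h0 := Real.summable_pow_mul_exp_neg_nat_mul 0 (r := 1 / 2) (by norm_num)
    refine ((h1.add h0).mul_left 2).congr fun j => ?_
    simp only [ha]; ring
  have ha0 : ∀ j, 0 ≤ a j := fun j => by positivity
  refine ⟨(∑' j, a j).toNNReal, fun g T x hg hT => ?_⟩
  have hsq : 0 < √T := Real.sqrt_pos.mpr hT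
  have hTs : T ^ (-(1 / 2) : ℝ) = (√T)⁻¹ := by
    rw [Real.rpow_neg hT.le, Real.sqrt_eq_rpow]
  set B : ℕ → Set ℝ := fun j => Metric.closedBall x ((j + 1) * √T) with hB
  have hpt : ∀ y, ENNReal.ofReal (T ^ (-(1 / 2) : ℝ) * Real.exp (-(x - y) ^ 2 / (2 * T))) * g y ≤
      ∑' j : ℕ, ENNReal.ofReal ((√T)⁻¹ * Real.exp (-(1 / 2) * j)) * (B j).indicator g y := by
    intro y
    set j := ⌊|x - y| / √T⌋₊ with hj
    have h1 : (j : ℝ) ≤ |x - y| / √T := Nat.floor_le (by positivity)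
    have h2 : |x - y| / √T < j + 1 := Nat.lt_floor_add_one _
    rw [div_lt_iff₀ hsq] at h2
    have hyB : y ∈ B j := by
      rw [hB, Metric.mem_closedBall, dist_comm, Real.dist_eq]; exact h2.le
    refine le_trans ?_ (ENNReal.le_tsum j)
    rw [indicator_of_mem hyB, hTs]
    gcongr
    have h3 : (j : ℝ) ^ 2 ≤ (x - y) ^ 2 / T := by
      have := pow_le_pow_left₀ (by positivity) h1 2
      rwa [div_pow, sq_abs, Real.sq_sqrt hT.le] at this
    have h4 : (j : ℝ) ≤ (j : ℝ) ^ 2 := by exact_mod_cast Nat.le_self_pow two_ne_zero j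
    have h5 : -(x - y) ^ 2 / (2 * T) = -(1 / 2) * ((x - y) ^ 2 / T) := by field_simp
    rw [h5]
    linarith
  refine (lintegral_mono hpt).trans ?_
  rw [lintegral_tsum fun j => ((hg.indicator measurableSet_closedBall).const_mul _).aemeasurable]
  have hj : ∀ j : ℕ, ∫⁻ y, ENNReal.ofReal ((√T)⁻¹ * Real.exp (-(1 / 2) * j)) *
      (B j).indicator g y ≤ ENNReal.ofReal (a j) * hlMax g x := by
    intro j
    rw [lintegral_const_mul' _ _ ofReal_ne_top, lintegral_indicator measurableSet_closedBall]
    refine (mul_le_mul_right (lintegral_closedBall_le_mul_hlMax g x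
      (by positivity : 0 < ((j : ℝ) + 1) * √T)) _).trans_eq ?_
    rw [← mul_assoc, ← ENNReal.ofReal_mul (by positivity)]
    congr 2
    simp only [ha]
    field_simp
  refine (ENNReal.tsum_le_tsum hj).trans_eq ?_
  rw [ENNReal.tsum_mul_right, ← ENNReal.ofReal_tsum_of_nonneg ha0 hs]
  rfl

lemma lintegral_rpow_le_measure_univ_mul {α : Type*} [MeasurableSpace α] (μ : Measure α)
    {p : ℝ} (hp : 1 < p) {h : α → ℝ≥0∞} (hh : AEMeasurable h μ) :
    (∫⁻ a, h a ∂μ) ^ p ≤ μ univ ^ (p - 1) * ∫⁻ a, h a ^ p ∂μ := by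
  have hpq := Real.HolderConjugate.conjExponent hp
  have h1 := ENNReal.lintegral_mul_le_Lp_mul_Lq μ hpq hh (aemeasurable_const (b := (1 : ℝ≥0∞)))
  simp only [Pi.mul_apply, mul_one, ENNReal.one_rpow, lintegral_one] at h1
  have hp0 : 0 < p := by linarith
  refine (ENNReal.rpow_le_rpow h1 hp0.le).trans_eq ?_
  rw [ENNReal.mul_rpow_of_nonneg _ _ hp0.le, ← ENNReal.rpow_mul, ← ENNReal.rpow_mul,
    one_div_mul_cancel hp0.ne', ENNReal.rpow_one, mul_comm]
  congr 2
  rw [Real.conjExponent]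
  field_simp

/-- A weighted Schur test. -/
lemma lintegral_lintegral_rpow_le {μ : Measure ℝ} [SFinite μ] {p : ℝ} (hp : 1 < p)
    {κ : ℝ → ℝ → ℝ≥0∞} (hκ : Measurable (Function.uncurry κ)) {h v A B : ℝ → ℝ≥0∞}
    (hh : Measurable h) (hv : Measurable v) (hAm : Measurable A)
    (hA : ∀ᵐ x ∂μ, ∫⁻ y, κ x y ∂μ ≤ A x)
    (hB : ∀ᵐ y ∂μ, ∫⁻ x, κ x y * (A x ^ (p - 1) * v x) ∂μ ≤ B y) :
    ∫⁻ x, (∫⁻ y, κ x y * h y ∂μ) ^ p * v x ∂μ ≤ ∫⁻ y, B y * h y ^ p ∂μ := by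
  have hp1 : 0 ≤ p - 1 := by linarith
  have hκx : ∀ x, Measurable (κ x) := fun x => hκ.comp measurable_prodMk_left
  have hκy : ∀ y, Measurable fun x => κ x y := fun y => hκ.comp measurable_prodMk_right
  calc ∫⁻ x, (∫⁻ y, κ x y * h y ∂μ) ^ p * v x ∂μ
      ≤ ∫⁻ x, ∫⁻ y, κ x y * (A x ^ (p - 1) * v x) * h y ^ p ∂μ ∂μ := by
        refine lintegral_mono_ae ?_
        filter_upwards [hA] with x hx
        have h1 := lintegral_rpow_le_measure_univ_mul (μ.withDensity (κ x)) hp hh.aemeasurable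
        rw [lintegral_withDensity_eq_lintegral_mul _ (hκx x) hh,
          lintegral_withDensity_eq_lintegral_mul _ (hκx x) (hh.pow_const p),
          withDensity_apply _ MeasurableSet.univ, Measure.restrict_univ] at h1
        simp only [Pi.mul_apply] at h1
        calc _ ≤ A x ^ (p - 1) * (∫⁻ y, κ x y * h y ^ p ∂μ) * v x := by
              refine mul_le_mul' (h1.trans (mul_le_mul' (ENNReal.rpow_le_rpow hx hp1) le_rfl)) le_rfl
          _ = (A x ^ (p - 1) * v x) * ∫⁻ y, κ x y * h y ^ p ∂μ := by ring
          _ = _ := by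
              have hm : Measurable fun y => κ x y * h y ^ p := (hκx x).mul (hh.pow_const p)
              rw [← lintegral_const_mul _ hm]
              exact lintegral_congr fun y => by ring
    _ = ∫⁻ y, ∫⁻ x, κ x y * (A x ^ (p - 1) * v x) * h y ^ p ∂μ ∂μ := by
        refine lintegral_lintegral_swap (Measurable.aemeasurable ?_)
        exact (hκ.mul (((hAm.pow_const _).mul hv).comp measurable_fst)).mul
          ((hh.pow_const p).comp measurable_snd)
    _ ≤ _ := by
        refine lintegral_mono_ae ?_
        filter_upwards [hB] with y hy
        have hm : Measurable fun x => κ x y * (A x ^ (p - 1) * v x) :=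
          (hκy y).mul ((hAm.pow_const _).mul hv)
        rw [lintegral_mul_const _ hm]
        exact mul_le_mul' hy le_rfl

lemma lintegral_hardy_le {p a δ s : ℝ} (hp : 1 < p) (hs0 : s ≠ 0) (hs : s * p = a * p - 1 - δ)
    {S : Set (ℝ × ℝ)} (hS : MeasurableSet S)
    (h1 : ∀ x, 0 < x → ∫⁻ y in Ioi 0, S.indicator (fun z => ENNReal.ofReal (z.2 ^ (s - 1))) (x, y) =
      ENNReal.ofReal (x ^ s / |s|))
    (h2 : ∀ y, 0 < y →
      ∫⁻ x in Ioi 0, S.indicator (fun z => ENNReal.ofReal (z.1 ^ (-s - 1))) (x, y) =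
      ENNReal.ofReal (y ^ (-s) / |s|)) (g : ℝ → ℝ≥0∞) (hg : Measurable g) :
    ∫⁻ x in Ioi 0, (ENNReal.ofReal (x ^ (-a)) *
      ∫⁻ y in Ioi 0, S.indicator (fun z => ENNReal.ofReal (z.2 ^ (a - 1)) * g z.2) (x, y)) ^ p *
        ENNReal.ofReal (x ^ δ) ≤
      ENNReal.ofReal (|s| ^ (-p)) * ∫⁻ x in Ioi 0, g x ^ p * ENNReal.ofReal (x ^ δ) := by
  have hp0 : 0 < p := by linarith
  have hsp : 0 < |s| := abs_pos.mpr hs0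
  have hmain := lintegral_lintegral_rpow_le (μ := volume.restrict (Ioi (0 : ℝ))) hp
    (κ := fun x y => S.indicator (fun z => ENNReal.ofReal (z.2 ^ (s - 1))) (x, y))
    (h := fun y => ENNReal.ofReal (y ^ (a - s)) * g y)
    (v := fun x => ENNReal.ofReal (x ^ (-a * p + δ)))
    (A := fun x => ENNReal.ofReal (x ^ s / |s|))
    (B := fun y => ENNReal.ofReal (|s| ^ (-p) * y⁻¹))
    (Measurable.indicator (by fun_prop) hS) (by fun_prop) (by fun_prop) (by fun_prop)
    (ae_restrict_of_forall_mem measurableSet_Ioi fun x hx => (h1 x hx).le)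
    (ae_restrict_of_forall_mem measurableSet_Ioi fun y hy => ?_)
  · refine le_trans (le_of_eq ?_) (hmain.trans_eq ?_)
    · refine setLIntegral_congr_fun measurableSet_Ioi fun x hx => ?_
      have hx : 0 < x := hx
      have e : ∫⁻ y in Ioi 0, S.indicator (fun z => ENNReal.ofReal (z.2 ^ (a - 1)) * g z.2) (x, y) =
          ∫⁻ y in Ioi 0, S.indicator (fun z => ENNReal.ofReal (z.2 ^ (s - 1))) (x, y) *
            (ENNReal.ofReal (y ^ (a - s)) * g y) := by
        refine setLIntegral_congr_fun measurableSet_Ioi fun y hy => ?_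
        have hy : 0 < y := hy
        by_cases hxy : (x, y) ∈ S
        · simp only [indicator_of_mem hxy]
          rw [← mul_assoc, ← ENNReal.ofReal_mul (by positivity), ← Real.rpow_add hy]
          congr 3; ring
        · simp only [indicator_of_notMem hxy, zero_mul]
      rw [e, ENNReal.mul_rpow_of_nonneg _ _ hp0.le, mul_comm (_ ^ p), mul_assoc,
        ENNReal.ofReal_rpow_of_nonneg (by positivity) hp0.le, ← ENNReal.ofReal_mul (by positivity),
        ← Real.rpow_mul hx.le, ← Real.rpow_add hx]
    · rw [← lintegral_const_mul _ (by fun_prop)]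
      refine setLIntegral_congr_fun measurableSet_Ioi fun y hy => ?_
      have hy : 0 < y := hy
      rw [ENNReal.mul_rpow_of_nonneg _ _ hp0.le,
        ENNReal.ofReal_rpow_of_nonneg (by positivity) hp0.le, ← mul_assoc,
        ← ENNReal.ofReal_mul (by positivity), mul_comm (g y ^ p), ← mul_assoc,
        ← ENNReal.ofReal_mul (by positivity), mul_assoc (|s| ^ (-p)), ← Real.rpow_neg_one,
        ← Real.rpow_mul hy.le, ← Real.rpow_add hy]
      congr 4
      linarith
  · have hy : 0 < y := hy
    have e : ∫⁻ x in Ioi 0, S.indicator (fun z => ENNReal.ofReal (z.2 ^ (s - 1))) (x, y) *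
        (ENNReal.ofReal (x ^ s / |s|) ^ (p - 1) * ENNReal.ofReal (x ^ (-a * p + δ))) =
        ∫⁻ x in Ioi 0, ENNReal.ofReal (y ^ (s - 1) * |s| ^ (1 - p)) *
          S.indicator (fun z => ENNReal.ofReal (z.1 ^ (-s - 1))) (x, y) := by
      refine setLIntegral_congr_fun measurableSet_Ioi fun x hx => ?_
      have hx : 0 < x := hx
      by_cases hxy : (x, y) ∈ S
      · simp only [indicator_of_mem hxy]
        rw [ENNReal.ofReal_rpow_of_nonneg (by positivity) (by linarith),
          ← ENNReal.ofReal_mul (by positivity), ← ENNReal.ofReal_mul (by positivity),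
          ← ENNReal.ofReal_mul (by positivity), mul_assoc]
        congr 2
        rw [Real.div_rpow (by positivity) hsp.le, show 1 - p = -(p - 1) by ring,
          Real.rpow_neg hsp.le, ← Real.rpow_mul hx.le, div_mul_eq_mul_div, ← Real.rpow_add hx,
          div_eq_inv_mul]
        congr 2
        linarith
      · simp only [indicator_of_notMem hxy, zero_mul, mul_zero]
    rw [e, lintegral_const_mul' _ _ ofReal_ne_top, h2 y hy, ← ENNReal.ofReal_mul (by positivity)]
    refine le_of_eq (congrArg _ ?_)
    rw [show -p = (1 - p) - 1 by ring, Real.rpow_sub_one hsp.ne', ← Real.rpow_neg_one y,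
      show (-1 : ℝ) = (s - 1) + -s by ring, Real.rpow_add hy]
    ring

lemma lintegral_Ioi_rpow {s a : ℝ} (hs : s < -1) (ha : 0 < a) :
    ∫⁻ l in Ioi a, ENNReal.ofReal (l ^ s) = ENNReal.ofReal (a ^ (s + 1) / -(s + 1)) := by
  rw [← ofReal_integral_eq_lintegral_ofReal (integrableOn_Ioi_rpow_of_lt hs ha)
    (ae_restrict_of_forall_mem measurableSet_Ioi fun l hl => Real.rpow_nonneg (ha.trans hl).le _),
    integral_Ioi_rpow_of_lt hs ha, neg_div, div_neg]

/-- Hardy's inequality for the averages over `(0,x)`. -/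
lemma exists_lintegral_hardy_zero_le {p a δ : ℝ} (hp : 1 < p) (h : δ < a * p - 1) :
    ∃ C : ℝ≥0, ∀ g : ℝ → ℝ≥0∞, Measurable g →
      ∫⁻ x in Ioi 0, (ENNReal.ofReal (x ^ (-a)) *
        ∫⁻ y in Ioo 0 x, ENNReal.ofReal (y ^ (a - 1)) * g y) ^ p * ENNReal.ofReal (x ^ δ) ≤
      C * ∫⁻ x in Ioi 0, g x ^ p * ENNReal.ofReal (x ^ δ) := by
  set s := (a * p - 1 - δ) / p with hs
  have hp0 : 0 < p := by linarith
  have hs0 : 0 < s := div_pos (by linarith) hp0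
  have hS : MeasurableSet {z : ℝ × ℝ | z.2 < z.1} := measurableSet_lt measurable_snd measurable_fst
  have e1 : ∀ (x : ℝ) (G : ℝ → ℝ≥0∞), ∫⁻ y in Ioi 0,
      {z : ℝ × ℝ | z.2 < z.1}.indicator (fun z => G z.2) (x, y) = ∫⁻ y in Ioo 0 x, G y := by
    intro x G
    rw [← Ioi_inter_Iio, inter_comm, ← setLIntegral_indicator measurableSet_Iio]
    rfl
  have e2 : ∀ (y : ℝ) (G : ℝ → ℝ≥0∞), 0 < y → ∫⁻ x in Ioi 0,
      {z : ℝ × ℝ | z.2 < z.1}.indicator (fun z => G z.1) (x, y) = ∫⁻ x in Ioi y, G x := by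
    intro y G hy
    rw [← inter_eq_left.mpr (Ioi_subset_Ioi hy.le), ← setLIntegral_indicator measurableSet_Ioi]
    rfl
  refine ⟨(|s| ^ (-p)).toNNReal, fun g hg => ?_⟩
  refine le_trans (le_of_eq ?_) (lintegral_hardy_le (a := a) (δ := δ) hp hs0.ne'
    (by rw [hs]; field_simp) hS ?_ ?_ g hg)
  · simp_rw [e1 _ fun y => ENNReal.ofReal (y ^ (a - 1)) * g y]
  · intro x hx
    rw [e1 x fun y => ENNReal.ofReal (y ^ (s - 1)), lintegral_Ioo_rpow (by linarith) hx.le,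
      sub_add_cancel, abs_of_pos hs0]
  · intro y hy
    rw [e2 y (fun y => ENNReal.ofReal (y ^ (-s - 1))) hy, lintegral_Ioi_rpow (by linarith) hy,
      sub_add_cancel, abs_of_pos hs0, neg_neg]

/-- Hardy's inequality for the averages over `(x,∞)`. -/
lemma exists_lintegral_hardy_top_le {p a δ : ℝ} (hp : 1 < p) (h : a * p - 1 < δ) :
    ∃ C : ℝ≥0, ∀ g : ℝ → ℝ≥0∞, Measurable g →
      ∫⁻ x in Ioi 0, (ENNReal.ofReal (x ^ (-a)) *
        ∫⁻ y in Ioi x, ENNReal.ofReal (y ^ (a - 1)) * g y) ^ p * ENNReal.ofReal (x ^ δ) ≤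
      C * ∫⁻ x in Ioi 0, g x ^ p * ENNReal.ofReal (x ^ δ) := by
  set s := (a * p - 1 - δ) / p with hs
  have hp0 : 0 < p := by linarith
  have hs0 : s < 0 := div_neg_of_neg_of_pos (by linarith) hp0
  have hS : MeasurableSet {z : ℝ × ℝ | z.1 < z.2} := measurableSet_lt measurable_fst measurable_snd
  have e1 : ∀ (x : ℝ) (G : ℝ → ℝ≥0∞), 0 < x → ∫⁻ y in Ioi 0,
      {z : ℝ × ℝ | z.1 < z.2}.indicator (fun z => G z.2) (x, y) = ∫⁻ y in Ioi x, G y := by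
    intro x G hx
    rw [← inter_eq_left.mpr (Ioi_subset_Ioi hx.le), ← setLIntegral_indicator measurableSet_Ioi]
    rfl
  have e2 : ∀ (y : ℝ) (G : ℝ → ℝ≥0∞), ∫⁻ x in Ioi 0,
      {z : ℝ × ℝ | z.1 < z.2}.indicator (fun z => G z.1) (x, y) = ∫⁻ x in Ioo 0 y, G x := by
    intro y G
    rw [← Ioi_inter_Iio, inter_comm, ← setLIntegral_indicator measurableSet_Iio]
    rfl
  refine ⟨(|s| ^ (-p)).toNNReal, fun g hg => ?_⟩
  refine le_trans (le_of_eq ?_) (lintegral_hardy_le (a := a) (δ := δ) hp hs0.ne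
    (by rw [hs]; field_simp) hS ?_ ?_ g hg)
  · refine setLIntegral_congr_fun measurableSet_Ioi fun x hx => ?_
    rw [e1 x (fun y => ENNReal.ofReal (y ^ (a - 1)) * g y) hx]
  · intro x hx
    rw [e1 x (fun y => ENNReal.ofReal (y ^ (s - 1))) hx, lintegral_Ioi_rpow (by linarith) hx,
      sub_add_cancel, abs_of_neg hs0]
  · intro y hy
    rw [e2 y (fun y => ENNReal.ofReal (y ^ (-s - 1))), lintegral_Ioo_rpow (by linarith) hy.le,
      sub_add_cancel, abs_of_neg hs0]

lemma rpow_neg_le_of_mem_Icc (β : ℝ) {x y : ℝ} (hx : 0 < x) (hy : 0 < y) (h1 : x ≤ 2 * y)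
    (h2 : y ≤ 2 * x) : y ^ (-β) ≤ 2 ^ |β| * x ^ (-β) := by
  have h : (x / y) ^ β ≤ 2 ^ |β| := by
    rcases le_total 0 β with hβ | hβ
    · rw [abs_of_nonneg hβ]
      exact Real.rpow_le_rpow (by positivity) (by rwa [div_le_iff₀ hy]) hβ
    · rw [abs_of_nonpos hβ, ← inv_div, Real.inv_rpow (by positivity),
        ← Real.rpow_neg (by positivity)]
      exact Real.rpow_le_rpow (by positivity) (by rwa [div_le_iff₀ hx]) (by linarith)
  have e : y ^ (-β) = (x / y) ^ β * x ^ (-β) := by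
    rw [Real.div_rpow hx.le hy.le, Real.rpow_neg hx.le, Real.rpow_neg hy.le]
    have := (Real.rpow_pos_of_pos hx β).ne'
    field_simp
  rw [e]
  exact mul_le_mul_of_nonneg_right h (by positivity)

lemma exists_lintegral_local_le (β : ℝ) :
    ∃ C : ℝ≥0, ∀ (F : ℝ → ℝ≥0∞) (T x : ℝ), Measurable F → 0 < T → 0 < x →
      ∫⁻ y in Icc (x / 2) (2 * x), ENNReal.ofReal (T ^ (-(1 / 2) : ℝ) *
        Real.exp (-(x - y) ^ 2 / (2 * T)) + x⁻¹) * F y ≤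
      C * (ENNReal.ofReal (x ^ (-β)) *
        hlMax ((Ioi 0).indicator fun y => ENNReal.ofReal (y ^ β) * F y) x) := by
  obtain ⟨C, hC⟩ := exists_lintegral_gaussian_mul_le
  refine ⟨Real.toNNReal (2 ^ |β|) * (C + 2), fun F T x hF hT hx => ?_⟩
  set g := (Ioi (0 : ℝ)).indicator fun y => ENNReal.ofReal (y ^ β) * F y with hg
  have hgm : Measurable g := Measurable.indicator (by fun_prop) measurableSet_Ioi
  have hFg : ∀ y ∈ Icc (x / 2) (2 * x), F y ≤ ENNReal.ofReal (2 ^ |β|) *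
      ENNReal.ofReal (x ^ (-β)) * g y := by
    intro y hy
    have hy0 : 0 < y := by linarith [hy.1]
    rw [hg, indicator_of_mem (mem_Ioi.mpr hy0), ← ENNReal.ofReal_mul (by positivity), ← mul_assoc]
    calc F y = ENNReal.ofReal (y ^ (-β)) * ENNReal.ofReal (y ^ β) * F y := by
          rw [← ENNReal.ofReal_mul (by positivity), ← Real.rpow_add hy0]; simp
      _ ≤ _ := by
          gcongr
          exact rpow_neg_le_of_mem_Icc β hx hy0 (by linarith [hy.1]) hy.2
  have h1 : ∫⁻ y in Icc (x / 2) (2 * x), ENNReal.ofReal (T ^ (-(1 / 2) : ℝ) *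
      Real.exp (-(x - y) ^ 2 / (2 * T))) * g y ≤ C * hlMax g x :=
    (setLIntegral_le_lintegral _ _).trans (hC g T x hgm hT)
  have h2 : ∫⁻ y in Icc (x / 2) (2 * x), ENNReal.ofReal x⁻¹ * g y ≤ 2 * hlMax g x := by
    rw [lintegral_const_mul' _ _ ofReal_ne_top]
    have hsub : Icc (x / 2) (2 * x) ⊆ Metric.closedBall x x := by
      rw [Real.closedBall_eq_Icc]
      exact Icc_subset_Icc (by linarith) (by linarith)
    refine (mul_le_mul_right ((lintegral_mono_set hsub).trans
      (lintegral_closedBall_le_mul_hlMax g x hx)) _).trans_eq ?_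
    rw [← mul_assoc, ← ENNReal.ofReal_mul (by positivity), mul_comm 2 x,
      inv_mul_cancel_left₀ hx.ne', ENNReal.ofReal_ofNat]
  calc ∫⁻ y in Icc (x / 2) (2 * x), ENNReal.ofReal (T ^ (-(1 / 2) : ℝ) *
        Real.exp (-(x - y) ^ 2 / (2 * T)) + x⁻¹) * F y
      ≤ ∫⁻ y in Icc (x / 2) (2 * x), ENNReal.ofReal (2 ^ |β|) * ENNReal.ofReal (x ^ (-β)) *
          (ENNReal.ofReal (T ^ (-(1 / 2) : ℝ) * Real.exp (-(x - y) ^ 2 / (2 * T))) * g y +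
            ENNReal.ofReal x⁻¹ * g y) := by
        refine setLIntegral_mono' measurableSet_Icc fun y hy => ?_
        refine (mul_le_mul_right (hFg y hy) _).trans_eq ?_
        rw [ENNReal.ofReal_add (by positivity) (by positivity)]
        ring
    _ = ENNReal.ofReal (2 ^ |β|) * ENNReal.ofReal (x ^ (-β)) *
          ((∫⁻ y in Icc (x / 2) (2 * x), ENNReal.ofReal (T ^ (-(1 / 2) : ℝ) *
            Real.exp (-(x - y) ^ 2 / (2 * T))) * g y) +
            ∫⁻ y in Icc (x / 2) (2 * x), ENNReal.ofReal x⁻¹ * g y) := by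
        rw [lintegral_const_mul' _ _ (by finiteness), lintegral_add_right _ (by fun_prop)]
    _ ≤ ENNReal.ofReal (2 ^ |β|) * ENNReal.ofReal (x ^ (-β)) *
          (C * hlMax g x + 2 * hlMax g x) := by gcongr
    _ = _ := by
        push_cast
        rw [ENNReal.ofReal]
        ring

lemma exists_lintegral_exoDensity_mul_le {ν : ℝ} (hν : ν < 1) (β : ℝ) :
    ∃ C : ℝ≥0, ∀ (F : ℝ → ℝ≥0∞) (t x : ℝ), Measurable F → 0 < t → 0 < x →
      ∫⁻ y in Ioi 0, ENNReal.ofReal (exoDensity ν t x y) * F y ≤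
      C * (ENNReal.ofReal (x ^ (-2 : ℝ)) *
          ∫⁻ y in Ioo 0 x, ENNReal.ofReal (y ^ ((2 : ℝ) - 1)) * F y) +
      C * (ENNReal.ofReal (x ^ (-(2 * ν))) *
          ∫⁻ y in Ioi x, ENNReal.ofReal (y ^ (2 * ν - 1)) * F y) +
      C * (ENNReal.ofReal (x ^ (-β)) *
        hlMax ((Ioi 0).indicator fun y => ENNReal.ofReal (y ^ β) * F y) x) := by
  obtain ⟨C₀, hC₀, h₀⟩ := exists_exoDensity_le hν
  obtain ⟨C₁, hC₁, h₁⟩ := exists_modelKernel_le_of_le hν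
  obtain ⟨C₂, hC₂, h₂⟩ := exists_modelKernel_le_of_ge hν
  obtain ⟨C₃, hC₃, h₃⟩ := exists_modelKernel_le_local hν
  obtain ⟨C₄, h₄⟩ := exists_lintegral_local_le β
  set C := C₀.toNNReal * (C₁.toNNReal + C₂.toNNReal + C₃.toNNReal * C₄) with hC
  have hc1 : C₀.toNNReal * C₁.toNNReal ≤ C := by
    rw [hC, add_assoc]; gcongr; exact le_self_add
  have hc2 : C₀.toNNReal * C₂.toNNReal ≤ C := by
    rw [hC, add_right_comm]; gcongr; exact le_add_self
  have hc3 : C₀.toNNReal * (C₃.toNNReal * C₄) ≤ C := by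
    rw [hC]; gcongr; exact le_add_self
  refine ⟨C, fun F t x hF ht hx => ?_⟩
  have hsub : Ioi (0 : ℝ) ⊆ (Ioo 0 (x / 2) ∪ Ioi (2 * x)) ∪ Icc (x / 2) (2 * x) := by
    intro y hy
    by_cases h1 : y < x / 2
    · exact Or.inl (Or.inl ⟨hy, h1⟩)
    · by_cases h2 : 2 * x < y
      · exact Or.inl (Or.inr h2)
      · exact Or.inr ⟨not_lt.mp h1, not_lt.mp h2⟩
  have ht2 : 0 < 2 * t := by positivity
  refine (lintegral_mono_set hsub).trans <| (lintegral_union_le _ _ _).trans <|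
    add_le_add ((lintegral_union_le _ _ _).trans (add_le_add ?_ ?_)) ?_
  · calc _ ≤ ∫⁻ y in Ioo 0 (x / 2), ENNReal.ofReal C₀ * ENNReal.ofReal C₁ *
          ENNReal.ofReal (x ^ (-2 : ℝ)) * (ENNReal.ofReal (y ^ ((2 : ℝ) - 1)) * F y) := by
          refine setLIntegral_mono' measurableSet_Ioo fun y hy => ?_
          have hy0 : 0 < y := hy.1
          rw [← mul_assoc, ← ENNReal.ofReal_mul hC₀.le, ← ENNReal.ofReal_mul (by positivity),
            ← ENNReal.ofReal_mul (by positivity)]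
          gcongr
          refine (h₀ t x y ht hx hy0).trans ?_
          rw [mul_assoc, mul_assoc]
          gcongr
          refine (h₁ _ x y ht2 hx hy0 (by linarith [hy.2])).trans_eq ?_
          norm_num
      _ ≤ ∫⁻ y in Ioo 0 x, ENNReal.ofReal C₀ * ENNReal.ofReal C₁ *
          ENNReal.ofReal (x ^ (-2 : ℝ)) * (ENNReal.ofReal (y ^ ((2 : ℝ) - 1)) * F y) :=
          lintegral_mono_set (Ioo_subset_Ioo_right (by linarith))
      _ ≤ _ := by
          rw [lintegral_const_mul' _ _ (by finiteness), mul_assoc]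
          exact mul_le_mul' (by simp only [ENNReal.ofReal]; exact_mod_cast hc1) le_rfl
  · calc _ ≤ ∫⁻ y in Ioi (2 * x), ENNReal.ofReal C₀ * ENNReal.ofReal C₂ *
          ENNReal.ofReal (x ^ (-(2 * ν))) * (ENNReal.ofReal (y ^ (2 * ν - 1)) * F y) := by
          refine setLIntegral_mono' measurableSet_Ioi fun y hy => ?_
          have hy' : 2 * x < y := hy
          have hy0 : 0 < y := by linarith
          rw [← mul_assoc, ← ENNReal.ofReal_mul hC₀.le, ← ENNReal.ofReal_mul (by positivity),
            ← ENNReal.ofReal_mul (by positivity)]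
          gcongr
          refine (h₀ t x y ht hx hy0).trans ?_
          rw [mul_assoc, mul_assoc]
          gcongr
          exact h₂ _ x y ht2 hx hy0 hy'.le
      _ ≤ ∫⁻ y in Ioi x, ENNReal.ofReal C₀ * ENNReal.ofReal C₂ *
          ENNReal.ofReal (x ^ (-(2 * ν))) * (ENNReal.ofReal (y ^ (2 * ν - 1)) * F y) :=
          lintegral_mono_set (Ioi_subset_Ioi (by linarith))
      _ ≤ _ := by
          rw [lintegral_const_mul' _ _ (by finiteness), mul_assoc]
          exact mul_le_mul' (by simp only [ENNReal.ofReal]; exact_mod_cast hc2) le_rfl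
  · calc _ ≤ ∫⁻ y in Icc (x / 2) (2 * x), ENNReal.ofReal C₀ * ENNReal.ofReal C₃ *
          (ENNReal.ofReal ((2 * t) ^ (-(1 / 2) : ℝ) *
            Real.exp (-(x - y) ^ 2 / (2 * (2 * t))) + x⁻¹) * F y) := by
          refine setLIntegral_mono' measurableSet_Icc fun y hy => ?_
          have hy0 : 0 < y := by linarith [hy.1]
          rw [← mul_assoc, ← ENNReal.ofReal_mul hC₀.le, ← ENNReal.ofReal_mul (by positivity)]
          gcongr
          refine (h₀ t x y ht hx hy0).trans ?_
          rw [mul_assoc]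
          gcongr
          exact h₃ _ x y ht2 hx hy0 (by linarith [hy.1]) hy.2
      _ ≤ _ := by
          rw [lintegral_const_mul' _ _ (by finiteness)]
          refine (mul_le_mul_right (h₄ F _ x hF ht2 hx) _).trans ?_
          rw [← mul_assoc, mul_assoc (ENNReal.ofReal C₀)]
          exact mul_le_mul' (by simp only [ENNReal.ofReal]; exact_mod_cast hc3) le_rfl

lemma ofReal_abs_WexoInt_le {ν : ℝ} (hν : ν < 1) {t x : ℝ} (ht : 0 < t) (hx : 0 < x)
    (f : ℝ → ℝ) : ENNReal.ofReal |WexoInt ν t f x| ≤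
      ∫⁻ y in Ioi 0, ENNReal.ofReal (exoDensity ν t x y) * ENNReal.ofReal |f y| := by
  rw [← Real.enorm_eq_ofReal_abs, WexoInt]
  refine (enorm_integral_le_lintegral_enorm _).trans_eq ?_
  rw [etaMeasure, lintegral_withDensity_eq_lintegral_mul_non_measurable _ (by fun_prop)
    (Filter.Eventually.of_forall fun _ => ofReal_lt_top)]
  refine setLIntegral_congr_fun measurableSet_Ioi fun y hy => ?_
  have hy : 0 < y := hy
  have h1 := exoDensity_nonneg hν ht hx hy
  rw [exoDensity] at h1 ⊢
  have h2 : 0 ≤ Wexo ν t x y := nonneg_of_mul_nonneg_left h1 (by positivity)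
  rw [Pi.mul_apply, Real.enorm_eq_ofReal_abs, abs_mul, abs_of_nonneg h2,
    ← ENNReal.ofReal_mul (by positivity), ← ENNReal.ofReal_mul (by positivity)]
  congr 1; ring

lemma lintegral_powMeasure (δ : ℝ) (G : ℝ → ℝ≥0∞) :
    ∫⁻ x, G x ∂(powMeasure δ) = ∫⁻ x in Ioi 0, G x * ENNReal.ofReal (x ^ δ) := by
  rw [powMeasure, lintegral_withDensity_eq_lintegral_mul_non_measurable _ (by fun_prop)
    (Filter.Eventually.of_forall fun _ => ofReal_lt_top)]
  exact lintegral_congr fun x => mul_comm _ _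

lemma restrict_absolutelyContinuous_powMeasure (δ : ℝ) :
    volume.restrict (Ioi (0 : ℝ)) ≪ powMeasure δ := by
  refine withDensity_absolutelyContinuous' (by fun_prop) ?_
  refine ae_restrict_of_forall_mem measurableSet_Ioi fun x hx => ?_
  have : 0 < x ^ δ := Real.rpow_pos_of_pos hx δ
  simpa using this

lemma WexoMax_congr (ν : ℝ) {f g : ℝ → ℝ} (h : f =ᵐ[volume.restrict (Ioi (0 : ℝ))] g) :
    WexoMax ν f = WexoMax ν g := by
  have h' : f =ᵐ[etaMeasure ν] g := (withDensity_absolutelyContinuous _ _).ae_le h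
  ext x
  have : ∀ t, WexoInt ν t f x = WexoInt ν t g x := fun t =>
    integral_congr_ae (h'.mono fun y hy => by simp only [hy])
  simp only [WexoMax, this]

lemma add_add_rpow_le {p : ℝ} (hp : 1 ≤ p) (a b c : ℝ≥0∞) :
    (a + b + c) ^ p ≤ 2 ^ (p - 1) * (2 ^ (p - 1) * (a ^ p + b ^ p) + c ^ p) :=
  (ENNReal.rpow_add_le_mul_rpow_add_rpow _ _ hp).trans <| by
    gcongr
    exact ENNReal.rpow_add_le_mul_rpow_add_rpow _ _ hp

lemma measurable_lintegral_Ioo (G : ℝ → ℝ≥0∞) : Measurable fun x => ∫⁻ y in Ioo 0 x, G y :=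
  Monotone.measurable fun _ _ h => lintegral_mono_set (Ioo_subset_Ioo_right h)

lemma exists_lintegral_WexoMax_rpow_le {ν δ p : ℝ} (hν : ν < 1) (hp : 1 < p)
    (h1 : 2 * ν * p - 1 < δ) (h2 : δ < 2 * p - 1) :
    ∃ C : ℝ≥0, ∀ f : ℝ → ℝ, MemLpPow f p δ →
      ∫⁻ x, WexoMax ν f x ^ p ∂(powMeasure δ) ≤
        C * ∫⁻ x, ENNReal.ofReal |f x| ^ p ∂(powMeasure δ) := by
  have hp0 : 0 < p := by linarith
  obtain ⟨C, hC⟩ := exists_lintegral_exoDensity_mul_le hν (δ / p)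
  obtain ⟨C₁, hC₁⟩ := exists_lintegral_hardy_zero_le hp h2
  obtain ⟨C₂, hC₂⟩ := exists_lintegral_hardy_top_le hp h1
  obtain ⟨C₃, hC₃⟩ := exists_lintegral_hlMax_rpow_le hp
  have htwo : (2 : ℝ≥0∞) ^ (p - 1) ≠ ⊤ := ENNReal.rpow_ne_top_of_nonneg (by linarith) (by simp)
  have hCp : (C : ℝ≥0∞) ^ p ≠ ⊤ := ENNReal.rpow_ne_top_of_nonneg hp0.le coe_ne_top
  set K : ℝ≥0∞ := C ^ p * (2 ^ (p - 1) * (2 ^ (p - 1) * (C₁ + C₂) + C₃)) with hK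
  refine ⟨K.toNNReal, fun f hf => ?_⟩
  rw [ENNReal.coe_toNNReal (by rw [hK]; finiteness)]
  wlog hfm : Measurable f generalizing f
  · have hae := hf.1.ae_eq_mk
    have hae' : (fun x => ENNReal.ofReal |f x| ^ p) =ᵐ[powMeasure δ]
        fun x => ENNReal.ofReal |hf.1.mk f x| ^ p := hae.mono fun x hx => by simp only [hx]
    have hmem : MemLpPow (hf.1.mk f) p δ :=
      ⟨hf.1.measurable_mk.aemeasurable, by rw [← lintegral_congr_ae hae']; exact hf.2⟩
    have := this _ hmem hf.1.measurable_mk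
    rwa [← WexoMax_congr ν ((restrict_absolutelyContinuous_powMeasure δ).ae_le hae),
      ← lintegral_congr_ae hae'] at this
  set F : ℝ → ℝ≥0∞ := fun y => ENNReal.ofReal |f y| with hF
  have hFm : Measurable F := by fun_prop
  set A₁ : ℝ → ℝ≥0∞ := fun x => ENNReal.ofReal (x ^ (-2 : ℝ)) *
    ∫⁻ y in Ioo 0 x, ENNReal.ofReal (y ^ ((2 : ℝ) - 1)) * F y with hA₁
  set A₂ : ℝ → ℝ≥0∞ := fun x => ENNReal.ofReal (x ^ (-(2 * ν))) *
    ∫⁻ y in Ioi x, ENNReal.ofReal (y ^ (2 * ν - 1)) * F y with hA₂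
  set g : ℝ → ℝ≥0∞ := (Ioi 0).indicator fun y => ENNReal.ofReal (y ^ (δ / p)) * F y with hg
  set A₃ : ℝ → ℝ≥0∞ := fun x => ENNReal.ofReal (x ^ (-(δ / p))) * hlMax g x with hA₃
  have hgm : Measurable g := Measurable.indicator (by fun_prop) measurableSet_Ioi
  have hA₁m : Measurable A₁ := Measurable.mul (by fun_prop) (measurable_lintegral_Ioo _)
  have hA₃m : Measurable A₃ := Measurable.mul (by fun_prop) (measurable_hlMax g)
  set w : ℝ → ℝ≥0∞ := fun x => ENNReal.ofReal (x ^ δ) with hw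
  have hwm : Measurable w := by fun_prop
  have hpt : ∀ x ∈ Ioi (0 : ℝ), WexoMax ν f x ≤ C * (A₁ x + A₂ x + A₃ x) := by
    intro x hx
    refine iSup₂_le fun t ht => ?_
    refine (ofReal_abs_WexoInt_le hν ht hx f).trans ((hC F t x hFm ht hx).trans_eq ?_)
    ring
  have hlocal : ∫⁻ x in Ioi 0, A₃ x ^ p * w x ≤ C₃ * ∫⁻ x in Ioi 0, F x ^ p * w x := by
    calc ∫⁻ x in Ioi 0, A₃ x ^ p * w x = ∫⁻ x in Ioi 0, hlMax g x ^ p := by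
          refine setLIntegral_congr_fun measurableSet_Ioi fun x hx => ?_
          have hx : 0 < x := hx
          simp only [hA₃, hw]
          rw [ENNReal.mul_rpow_of_nonneg _ _ hp0.le, ENNReal.ofReal_rpow_of_nonneg (by positivity)
            hp0.le, mul_right_comm, ← ENNReal.ofReal_mul (by positivity), ← Real.rpow_mul hx.le,
            ← Real.rpow_add hx, neg_mul, div_mul_cancel₀ _ hp0.ne', neg_add_cancel, Real.rpow_zero,
            ENNReal.ofReal_one, one_mul]
      _ ≤ ∫⁻ x, hlMax g x ^ p := setLIntegral_le_lintegral _ _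
      _ ≤ C₃ * ∫⁻ x, g x ^ p := hC₃ g hgm
      _ = C₃ * ∫⁻ x in Ioi 0, F x ^ p * w x := by
          congr 1
          rw [← lintegral_indicator measurableSet_Ioi]
          refine lintegral_congr fun x => ?_
          by_cases hx : x ∈ Ioi (0 : ℝ)
          · have hx' : 0 < x := hx
            rw [hg, indicator_of_mem hx, indicator_of_mem hx, ENNReal.mul_rpow_of_nonneg _ _ hp0.le,
              ENNReal.ofReal_rpow_of_nonneg (by positivity) hp0.le, ← Real.rpow_mul hx'.le,
              div_mul_cancel₀ _ hp0.ne', mul_comm]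
          · rw [hg, indicator_of_notMem hx, indicator_of_notMem hx, ENNReal.zero_rpow_of_pos hp0]
  rw [lintegral_powMeasure, lintegral_powMeasure]
  calc ∫⁻ x in Ioi 0, WexoMax ν f x ^ p * w x
      ≤ ∫⁻ x in Ioi 0, (C ^ p * (2 ^ (p - 1) * (2 ^ (p - 1) *
          (A₁ x ^ p * w x + A₂ x ^ p * w x) + A₃ x ^ p * w x))) := by
        refine setLIntegral_mono' measurableSet_Ioi fun x hx => ?_
        calc WexoMax ν f x ^ p * w x ≤ (C * (A₁ x + A₂ x + A₃ x)) ^ p * w x := by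
              gcongr; exact hpt x hx
          _ ≤ C ^ p * (2 ^ (p - 1) * (2 ^ (p - 1) * (A₁ x ^ p + A₂ x ^ p) + A₃ x ^ p)) * w x := by
              rw [ENNReal.mul_rpow_of_nonneg _ _ hp0.le]
              gcongr
              exact add_add_rpow_le hp.le _ _ _
          _ = _ := by ring
    _ = C ^ p * (2 ^ (p - 1) * (2 ^ (p - 1) * ((∫⁻ x in Ioi 0, A₁ x ^ p * w x) +
          ∫⁻ x in Ioi 0, A₂ x ^ p * w x) + ∫⁻ x in Ioi 0, A₃ x ^ p * w x)) := by
        rw [lintegral_const_mul' _ _ hCp, lintegral_const_mul' _ _ htwo,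
          lintegral_add_right _ (by fun_prop), lintegral_const_mul' _ _ htwo,
          lintegral_add_left (by fun_prop)]
    _ ≤ C ^ p * (2 ^ (p - 1) * (2 ^ (p - 1) * (C₁ * (∫⁻ x in Ioi 0, F x ^ p * w x) +
          C₂ * ∫⁻ x in Ioi 0, F x ^ p * w x) + C₃ * ∫⁻ x in Ioi 0, F x ^ p * w x)) := by
        gcongr
        · exact hC₁ F hFm
        · exact hC₂ F hFm
    _ = _ := by rw [hK]; ring

lemma exists_essSup_WexoMax_le {ν : ℝ} (hν : ν < 0) :
    ∃ C : ℝ≥0, ∀ f : ℝ → ℝ, essSup (WexoMax ν f) (volume.restrict (Ioi (0 : ℝ))) ≤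
      C * eLpNorm f ⊤ (volume.restrict (Ioi (0 : ℝ))) := by
  obtain ⟨C, hC⟩ := exists_lintegral_exoDensity_mul_le (show ν < 1 by linarith) 0
  refine ⟨C * Real.toNNReal (1 / 2) + C * Real.toNNReal (1 / -(2 * ν)) + C, fun f => ?_⟩
  rw [eLpNorm_exponent_top]
  set M := eLpNormEssSup f (volume.restrict (Ioi (0 : ℝ))) with hM
  refine essSup_le_of_ae_le _ (ae_restrict_of_forall_mem measurableSet_Ioi fun x hx => ?_)
  have hx : 0 < x := hx
  refine iSup₂_le fun t ht => (ofReal_abs_WexoInt_le (by linarith) ht hx f).trans ?_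
  have hae : ∀ᵐ y ∂volume.restrict (Ioi (0 : ℝ)), ENNReal.ofReal |f y| ≤ M := by
    filter_upwards [ae_le_eLpNormEssSup (f := f) (μ := volume.restrict (Ioi (0 : ℝ)))] with y hy
    rwa [← Real.enorm_eq_ofReal_abs]
  have h1 : ∫⁻ y in Ioo 0 x, ENNReal.ofReal (y ^ ((2 : ℝ) - 1)) * M =
      ENNReal.ofReal (x ^ (2 : ℝ) / 2) * M := by
    rw [lintegral_mul_const _ (by fun_prop), lintegral_Ioo_rpow (by norm_num) hx.le]
    norm_num
  have h2 : ∫⁻ y in Ioi x, ENNReal.ofReal (y ^ (2 * ν - 1)) * M =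
      ENNReal.ofReal (x ^ (2 * ν) / -(2 * ν)) * M := by
    rw [lintegral_mul_const _ (by fun_prop), lintegral_Ioi_rpow (by linarith) hx, sub_add_cancel]
  have h3 : hlMax ((Ioi 0).indicator fun y => ENNReal.ofReal (y ^ (0 : ℝ)) * M) x ≤ M := by
    refine (hlMax_mono (fun y => ?_) x).trans (hlMax_const_le M x)
    refine (indicator_le_self _ _ y).trans ?_
    simp
  calc _ ≤ ∫⁻ y in Ioi 0, ENNReal.ofReal (exoDensity ν t x y) * M :=
        lintegral_mono_ae (hae.mono fun y hy => mul_le_mul_right hy _)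
    _ ≤ _ := hC _ t x measurable_const ht hx
    _ ≤ C * (ENNReal.ofReal (x ^ (-2 : ℝ)) * (ENNReal.ofReal (x ^ (2 : ℝ) / 2) * M)) +
        C * (ENNReal.ofReal (x ^ (-(2 * ν))) * (ENNReal.ofReal (x ^ (2 * ν) / -(2 * ν)) * M)) +
        C * (ENNReal.ofReal (x ^ (-0 : ℝ)) * M) := by
        rw [h1, h2]
        gcongr
    _ = _ := by
        have hν' : 0 < -(2 * ν) := by linarith
        rw [← mul_assoc (ENNReal.ofReal _), ← mul_assoc (ENNReal.ofReal _) (ENNReal.ofReal _),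
          ← ENNReal.ofReal_mul (by positivity),
          ← ENNReal.ofReal_mul (by positivity), mul_div_assoc', mul_div_assoc', ← Real.rpow_add hx,
          ← Real.rpow_add hx, neg_add_cancel, neg_add_cancel, Real.rpow_zero, neg_zero,
          Real.rpow_zero, ENNReal.ofReal_one]
        push_cast
        simp only [ENNReal.ofReal]
        ring

lemma measurable_besselI (μ : ℝ) : Measurable (besselI μ) := by
  refine Measurable.tsum fun n => ?_
  fun_prop

lemma measurable_Wexo (ν t x : ℝ) : Measurable (Wexo ν t x) := by
  unfold Wexo Wcls
  have := measurable_besselI (-ν)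
  fun_prop

lemma continuousOn_modelKernel (ν : ℝ) {T x : ℝ} (hT : 0 < T) (hx : 0 < x) :
    ContinuousOn (modelKernel ν T x) (Ici 0) := by
  unfold modelKernel
  have h : ContinuousOn (fun y => (T + x * y) ^ (ν - 1 / 2)) (Ici 0) := by
    refine ContinuousOn.rpow_const (by fun_prop) fun y hy => Or.inl ?_
    have hy : 0 ≤ y := hy
    positivity
  fun_prop

lemma lintegral_exoDensity_le_ofReal_abs_WexoInt {ν : ℝ} (hν : ν < 1) {t x a b : ℝ} (ht : 0 < t)
    (hx : 0 < x) (ha : 0 ≤ a) :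
    ∫⁻ y in Ioo a b, ENNReal.ofReal (exoDensity ν t x y) ≤
      ENNReal.ofReal |WexoInt ν t ((Ioo a b).indicator 1) x| := by
  have hsub : Ioo a b ⊆ Ioi 0 := fun y hy => ha.trans_lt hy.1
  have hG : ∀ y ∈ Ioi (0 : ℝ), 0 ≤ Wexo ν t x y * (Ioo a b).indicator 1 y := by
    intro y hy
    have hy : 0 < y := hy
    have h1 := exoDensity_nonneg hν ht hx hy
    rw [exoDensity] at h1
    exact mul_nonneg (nonneg_of_mul_nonneg_left h1 (by positivity))
      (indicator_nonneg (fun _ _ => zero_le_one) _)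
  have hGae : 0 ≤ᵐ[etaMeasure ν] fun y => Wexo ν t x y * (Ioo a b).indicator 1 y :=
    (withDensity_absolutelyContinuous _ _).ae_le
      (ae_restrict_of_forall_mem measurableSet_Ioi hG)
  have hm : Measurable fun y => Wexo ν t x y * (Ioo a b).indicator 1 y :=
    (measurable_Wexo ν t x).mul (measurable_one.indicator measurableSet_Ioo)
  have hval : ∫⁻ y, ENNReal.ofReal (Wexo ν t x y * (Ioo a b).indicator 1 y) ∂(etaMeasure ν) =
      ∫⁻ y in Ioo a b, ENNReal.ofReal (exoDensity ν t x y) := by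
    have e : ∫⁻ y in Ioo a b, ENNReal.ofReal (exoDensity ν t x y) = ∫⁻ y in Ioi 0,
        (Ioo a b).indicator (fun y => ENNReal.ofReal (exoDensity ν t x y)) y := by
      rw [setLIntegral_indicator measurableSet_Ioo, inter_eq_left.mpr hsub]
    rw [e, etaMeasure, lintegral_withDensity_eq_lintegral_mul _ (by fun_prop) (by fun_prop)]
    refine setLIntegral_congr_fun measurableSet_Ioi fun y hy => ?_
    have hy : 0 < y := hy
    rw [Pi.mul_apply, ← ENNReal.ofReal_mul (by positivity)]
    by_cases hyI : y ∈ Ioo a b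
    · rw [indicator_of_mem hyI, indicator_of_mem hyI, exoDensity]
      simp [mul_comm]
    · rw [indicator_of_notMem hyI, indicator_of_notMem hyI]
      simp
  have hfin : ∫⁻ y in Ioo a b, ENNReal.ofReal (exoDensity ν t x y) < ⊤ := by
    obtain ⟨C, hC, h⟩ := exists_exoDensity_le hν
    have hcont : ContinuousOn (fun y => C * modelKernel ν (2 * t) x y) (Icc a b) :=
      ((continuousOn_modelKernel ν (by positivity) hx).mono fun y hy => ha.trans hy.1).const_mul C
    have hfin := ((hcont.integrableOn_Icc (μ := volume)).mono_set
      Ioo_subset_Icc_self).setLIntegral_lt_top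
    refine lt_of_le_of_lt ?_ hfin
    exact setLIntegral_mono' measurableSet_Ioo fun y hy =>
      ENNReal.ofReal_le_ofReal (h t x y ht hx (hsub hy))
  have hInteg : Integrable (fun y => Wexo ν t x y * (Ioo a b).indicator 1 y) (etaMeasure ν) := by
    rw [← lintegral_ofReal_ne_top_iff_integrable hm.aestronglyMeasurable hGae, hval]
    exact hfin.ne
  rw [← hval, ← ofReal_integral_eq_lintegral_ofReal hInteg hGae]
  exact ENNReal.ofReal_le_ofReal (le_abs_self _)

lemma exists_le_WexoMax_indicator {ν : ℝ} (hν : ν < 1) :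
    ∃ c : ℝ, 0 < c ∧ ∀ a b m T x : ℝ, 0 ≤ a → a < b → 0 < T → 0 < x → 0 ≤ m →
      (∀ y ∈ Ioo a b, m ≤ modelKernel ν T x y) →
      ENNReal.ofReal (c * (m * (b - a))) ≤ WexoMax ν ((Ioo a b).indicator 1) x := by
  obtain ⟨c, hc, h⟩ := exists_le_exoDensity hν
  refine ⟨c, hc, fun a b m T x ha hab hT hx hm hmk => ?_⟩
  have ht : 0 < T / 2 := by positivity
  refine le_trans ?_ ((lintegral_exoDensity_le_ofReal_abs_WexoInt hν ht hx ha).trans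
    (le_iSup₂ (f := fun t (_ : t ∈ Ioi (0 : ℝ)) =>
      ENNReal.ofReal |WexoInt ν t ((Ioo a b).indicator 1) x|) (T / 2) ht))
  calc ENNReal.ofReal (c * (m * (b - a))) = ∫⁻ y in Ioo a b, ENNReal.ofReal (c * m) := by
        rw [setLIntegral_const, Real.volume_Ioo, ← ENNReal.ofReal_mul (by positivity), mul_assoc]
    _ ≤ _ := by
        refine setLIntegral_mono' measurableSet_Ioo fun y hy => ENNReal.ofReal_le_ofReal ?_
        have h1 := h (T / 2) x y ht hx (ha.trans_lt hy.1)
        rw [mul_div_cancel₀ _ two_ne_zero] at h1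
        exact (mul_le_mul_of_nonneg_left (hmk y hy) hc.le).trans h1

lemma rpow_neg_abs_le_rpow {K u : ℝ} (s : ℝ) (h1 : 1 ≤ u) (h2 : u ≤ K) : K ^ (-|s|) ≤ u ^ s :=
  (Real.rpow_le_rpow_of_nonpos (by linarith) h2 (neg_nonpos.mpr (abs_nonneg s))).trans
    (Real.rpow_le_rpow_of_exponent_le h1 (neg_abs_le s))

lemma le_modelKernel_near_zero {ν x y : ℝ} (hx0 : 0 < x) (hx1 : x < 1) (hy : y ∈ Ioo (1 : ℝ) 2) :
    3 ^ (-|ν - 1 / 2|) * Real.exp (-2) * x ^ (-(2 * ν)) ≤ modelKernel ν 1 x y := by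
  obtain ⟨hy1, hy2⟩ := hy
  have hxy : 0 < x * y := by positivity
  have h1 : (3 : ℝ) ^ (-|ν - 1 / 2|) ≤ (1 + x * y) ^ (ν - 1 / 2) :=
    rpow_neg_abs_le_rpow _ (by linarith) (by nlinarith)
  have h2 : Real.exp (-2) ≤ Real.exp (-(x - y) ^ 2 / (2 * 1)) :=
    Real.exp_le_exp.mpr (by nlinarith)
  calc _ = 1 * x ^ (-(2 * ν)) * 1 * 3 ^ (-|ν - 1 / 2|) * Real.exp (-2) := by ring
    _ ≤ _ := by
      rw [modelKernel, Real.one_rpow]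
      gcongr

lemma le_modelKernel_near_top {ν x y : ℝ} (hx : 2 < x) (hy : y ∈ Ioo (1 : ℝ) 2) :
    2 ^ (-|ν - 1 / 2|) * Real.exp (-(1 / 2)) * x ^ (-2 : ℝ) ≤ modelKernel ν (x ^ 2) x y := by
  obtain ⟨hy1, hy2⟩ := hy
  have hx0 : 0 < x := by linarith
  have hy0 : 0 < y := by linarith
  have hq : 0 < y / x := by positivity
  have h1 : (2 : ℝ) ^ (-|ν - 1 / 2|) ≤ (1 + y / x) ^ (ν - 1 / 2) :=
    rpow_neg_abs_le_rpow _ (by linarith) (by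
      have : y / x ≤ 1 := by rw [div_le_one hx0]; linarith
      linarith)
  have h2 : Real.exp (-(1 / 2)) ≤ Real.exp (-(x - y) ^ 2 / (2 * x ^ 2)) := by
    refine Real.exp_le_exp.mpr ?_
    rw [le_div_iff₀ (by positivity)]
    nlinarith
  have e1 : (x ^ 2 + x * y) ^ (ν - 1 / 2) = x ^ (2 * ν - 1) * (1 + y / x) ^ (ν - 1 / 2) := by
    rw [show x ^ 2 + x * y = x ^ (2 : ℝ) * (1 + y / x) by rw [Real.rpow_two]; field_simp,
      Real.mul_rpow (by positivity) (by positivity), ← Real.rpow_mul hx0.le]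
    congr 2; ring
  have e2 : (x ^ 2) ^ (-(1 / 2) : ℝ) = x ^ (-1 : ℝ) := by
    rw [← Real.rpow_two, ← Real.rpow_mul hx0.le]; norm_num
  have e3 : x ^ (-2 : ℝ) = x ^ (-1 : ℝ) * x ^ (-(2 * ν)) * x ^ (2 * ν - 1) := by
    rw [← Real.rpow_add hx0, ← Real.rpow_add hx0]; congr 1; ring
  calc _ = x ^ (-1 : ℝ) * x ^ (-(2 * ν)) * 1 * (x ^ (2 * ν - 1) * 2 ^ (-|ν - 1 / 2|)) *
        Real.exp (-(1 / 2)) := by rw [e3]; ring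
    _ ≤ _ := by
      rw [modelKernel, e1, e2]
      gcongr

lemma le_modelKernel_near_one {ν ε x y : ℝ} (hε : 0 < ε) (hx : x ∈ Ioo (1 + ε) 2)
    (hy : y ∈ Ioo 1 (1 + ε)) :
    2 ^ (-|-(2 * ν)|) * 5 ^ (-|ν - 1 / 2|) * Real.exp (-(1 / 2)) * (x - 1)⁻¹ ≤
      modelKernel ν ((x - 1) ^ 2) x y := by
  obtain ⟨hx1, hx2⟩ := hx
  obtain ⟨hy1, hy2⟩ := hy
  have hu : 0 < x - 1 := by linarith
  have h0 : (2 : ℝ) ^ (-|-(2 * ν)|) ≤ x ^ (-(2 * ν)) :=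
    rpow_neg_abs_le_rpow _ (by linarith) hx2.le
  have h1 : (5 : ℝ) ^ (-|ν - 1 / 2|) ≤ ((x - 1) ^ 2 + x * y) ^ (ν - 1 / 2) :=
    rpow_neg_abs_le_rpow _ (by nlinarith) (by nlinarith)
  have h2 : Real.exp (-(1 / 2)) ≤ Real.exp (-(x - y) ^ 2 / (2 * (x - 1) ^ 2)) := by
    refine Real.exp_le_exp.mpr ?_
    rw [le_div_iff₀ (by positivity)]
    nlinarith
  have e2 : ((x - 1) ^ 2) ^ (-(1 / 2) : ℝ) = (x - 1)⁻¹ := by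
    rw [← Real.rpow_two, ← Real.rpow_mul hu.le, ← Real.rpow_neg_one]; norm_num
  have hx0 : 0 < x := by linarith
  calc _ = (x - 1)⁻¹ * 2 ^ (-|-(2 * ν)|) * 1 * 5 ^ (-|ν - 1 / 2|) * Real.exp (-(1 / 2)) := by ring
    _ ≤ _ := by
      rw [modelKernel, e2]
      gcongr

lemma lintegral_Ioo_rpow_eq_top {s : ℝ} (hs : s ≤ -1) :
    ∫⁻ x in Ioo (0 : ℝ) 1, ENNReal.ofReal (x ^ s) = ⊤ := by
  by_contra h
  have hm : Measurable fun x : ℝ => x ^ s := by fun_prop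
  rw [← ne_eq, lintegral_ofReal_ne_top_iff_integrable hm.aestronglyMeasurable
    (ae_restrict_of_forall_mem measurableSet_Ioo fun x hx => Real.rpow_nonneg hx.1.le s)] at h
  exact absurd ((intervalIntegral.integrableOn_Ioo_rpow_iff one_pos).mp h) (not_lt.mpr hs)

lemma lintegral_Ioi_rpow_eq_top {s : ℝ} (hs : -1 ≤ s) :
    ∫⁻ x in Ioi (2 : ℝ), ENNReal.ofReal (x ^ s) = ⊤ := by
  by_contra h
  have hm : Measurable fun x : ℝ => x ^ s := by fun_prop
  rw [← ne_eq, lintegral_ofReal_ne_top_iff_integrable hm.aestronglyMeasurable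
    (ae_restrict_of_forall_mem measurableSet_Ioi fun x hx =>
      Real.rpow_nonneg (two_pos.trans hx).le s)] at h
  exact absurd ((integrableOn_Ioi_rpow_iff two_pos).mp h) (not_lt.mpr hs)

lemma lintegral_Ioo_sub_one_inv {ε : ℝ} (h0 : 0 < ε) (h1 : ε < 1) :
    ∫⁻ x in Ioo (1 + ε) 2, ENNReal.ofReal (x - 1)⁻¹ = ENNReal.ofReal (Real.log ε⁻¹) := by
  have hcont : ContinuousOn (fun x : ℝ => (x - 1)⁻¹) (Icc (1 + ε) 2) :=
    ContinuousOn.inv₀ (by fun_prop) fun x hx => by linarith [hx.1]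
  rw [setLIntegral_congr Ioo_ae_eq_Ioc, ← ofReal_integral_eq_lintegral_ofReal
    (hcont.integrableOn_Icc.mono_set Ioc_subset_Icc_self)
    (ae_restrict_of_forall_mem measurableSet_Ioc fun x hx => inv_nonneg.mpr (by linarith [hx.1])),
    ← intervalIntegral.integral_of_le (by linarith),
    intervalIntegral.integral_comp_sub_right (fun x => x⁻¹) 1,
    integral_inv_of_pos (by linarith) (by norm_num)]
  congr 2
  field_simp
  norm_num
  exact h0.ne'

lemma lintegral_indicator_powMeasure_le (δ : ℝ) {p ε : ℝ} (hp : 0 < p) (h1 : ε ≤ 1) :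
    ∫⁻ x, ENNReal.ofReal |(Ioo 1 (1 + ε)).indicator (1 : ℝ → ℝ) x| ^ p ∂(powMeasure δ) ≤
      ENNReal.ofReal (2 ^ |δ| * ε) := by
  rw [lintegral_powMeasure]
  calc _ ≤ ∫⁻ x, (Ioo 1 (1 + ε)).indicator (fun _ => ENNReal.ofReal (2 ^ |δ|)) x := by
        refine (setLIntegral_le_lintegral _ _).trans (lintegral_mono fun x => ?_)
        by_cases hx : x ∈ Ioo 1 (1 + ε)
        · rw [indicator_of_mem hx, indicator_of_mem hx]
          simp only [Pi.one_apply, abs_one, ENNReal.ofReal_one, ENNReal.one_rpow, one_mul]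
          refine ENNReal.ofReal_le_ofReal ?_
          exact (Real.rpow_le_rpow_of_exponent_le hx.1.le (le_abs_self δ)).trans
            (Real.rpow_le_rpow (by linarith [hx.1]) (by linarith [hx.2]) (abs_nonneg δ))
        · rw [indicator_of_notMem hx, indicator_of_notMem hx]
          simp [hp]
    _ = _ := by
        rw [lintegral_indicator_const measurableSet_Ioo, Real.volume_Ioo, add_sub_cancel_left,
          ← ENNReal.ofReal_mul (by positivity)]

lemma memLpPow_indicator (δ : ℝ) {p ε : ℝ} (hp : 0 < p) (h1 : ε ≤ 1) :
    MemLpPow ((Ioo 1 (1 + ε)).indicator 1) p δ :=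
  ⟨(measurable_one.indicator measurableSet_Ioo).aemeasurable,
    (lintegral_indicator_powMeasure_le δ hp h1).trans_lt ofReal_lt_top⟩

lemma lintegral_powMeasure_eq_top {δ p c s : ℝ} {G : ℝ → ℝ≥0∞} {S : Set ℝ} (hp : 0 ≤ p)
    (hc : 0 < c) (hS : MeasurableSet S) (hS0 : S ⊆ Ioi 0)
    (hG : ∀ x ∈ S, ENNReal.ofReal (c * x ^ s) ≤ G x)
    (htop : ∫⁻ x in S, ENNReal.ofReal (x ^ (s * p + δ)) = ⊤) :
    ∫⁻ x, G x ^ p ∂(powMeasure δ) = ⊤ := by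
  rw [lintegral_powMeasure, eq_top_iff]
  calc (⊤ : ℝ≥0∞) = ENNReal.ofReal (c ^ p) * ∫⁻ x in S, ENNReal.ofReal (x ^ (s * p + δ)) := by
        rw [htop, ENNReal.mul_top]
        have : 0 < c ^ p := by positivity
        simpa using this
    _ = ∫⁻ x in S, ENNReal.ofReal (c * x ^ s) ^ p * ENNReal.ofReal (x ^ δ) := by
        rw [← lintegral_const_mul' _ _ ofReal_ne_top]
        refine setLIntegral_congr_fun hS fun x hx => ?_
        have hx : 0 < x := hS0 hx
        rw [ENNReal.ofReal_rpow_of_nonneg (by positivity) hp, ← ENNReal.ofReal_mul (by positivity),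
          ← ENNReal.ofReal_mul (by positivity), Real.mul_rpow hc.le (by positivity),
          ← Real.rpow_mul hx.le, mul_assoc, ← Real.rpow_add hx]
    _ ≤ ∫⁻ x in S, G x ^ p * ENNReal.ofReal (x ^ δ) := by
        refine setLIntegral_mono' hS fun x hx => ?_
        gcongr
        exact hG x hx
    _ ≤ _ := lintegral_mono_set hS0

lemma exists_le_WexoMax_near_zero {ν : ℝ} (hν : ν < 1) :
    ∃ c : ℝ, 0 < c ∧ ∀ x ∈ Ioo (0 : ℝ) 1,
      ENNReal.ofReal (c * x ^ (-(2 * ν))) ≤ WexoMax ν ((Ioo 1 (1 + 1)).indicator 1) x := by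
  obtain ⟨c, hc, h⟩ := exists_le_WexoMax_indicator hν
  refine ⟨c * (3 ^ (-|ν - 1 / 2|) * Real.exp (-2)), by positivity, fun x hx => ?_⟩
  have hx0 : 0 < x := hx.1
  refine le_trans (le_of_eq ?_) (h 1 (1 + 1) _ 1 x zero_le_one (by norm_num) one_pos hx0
    (by positivity) fun y hy => le_modelKernel_near_zero hx0 hx.2 (by norm_num at hy ⊢; exact hy))
  congr 1; ring

lemma exists_le_WexoMax_near_top {ν : ℝ} (hν : ν < 1) :
    ∃ c : ℝ, 0 < c ∧ ∀ x ∈ Ioi (2 : ℝ),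
      ENNReal.ofReal (c * x ^ (-2 : ℝ)) ≤ WexoMax ν ((Ioo 1 (1 + 1)).indicator 1) x := by
  obtain ⟨c, hc, h⟩ := exists_le_WexoMax_indicator hν
  refine ⟨c * (2 ^ (-|ν - 1 / 2|) * Real.exp (-(1 / 2))), by positivity, fun x hx => ?_⟩
  have hx0 : 0 < x := two_pos.trans hx
  refine le_trans (le_of_eq ?_) (h 1 (1 + 1) _ (x ^ 2) x zero_le_one (by norm_num) (by positivity)
    hx0 (by positivity) fun y hy => le_modelKernel_near_top hx (by norm_num at hy ⊢; exact hy))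
  congr 1; ring

lemma exists_le_WexoMax_near_one {ν : ℝ} (hν : ν < 1) :
    ∃ c : ℝ, 0 < c ∧ ∀ ε : ℝ, 0 < ε → ∀ x ∈ Ioo (1 + ε) 2,
      ENNReal.ofReal (c * ε * (x - 1)⁻¹) ≤ WexoMax ν ((Ioo 1 (1 + ε)).indicator 1) x := by
  obtain ⟨c, hc, h⟩ := exists_le_WexoMax_indicator hν
  refine ⟨c * (2 ^ (-|-(2 * ν)|) * 5 ^ (-|ν - 1 / 2|) * Real.exp (-(1 / 2))), by positivity,
    fun ε hε x hx => ?_⟩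
  have hx1 : 0 < x - 1 := by linarith [hx.1]
  refine le_trans (le_of_eq ?_) (h 1 (1 + ε) _ ((x - 1) ^ 2) x zero_le_one (by linarith)
    (by positivity) (by linarith) (by positivity) fun y hy => le_modelKernel_near_one hε hx hy)
  congr 1; ring

lemma lt_of_lintegral_WexoMax_rpow_le {ν δ p : ℝ} (hν : ν < 1) (hp : 0 < p) {C : ℝ≥0}
    (h : ∀ f : ℝ → ℝ, MemLpPow f p δ → ∫⁻ x, WexoMax ν f x ^ p ∂(powMeasure δ) ≤
      C * ∫⁻ x, ENNReal.ofReal |f x| ^ p ∂(powMeasure δ)) :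
    2 * ν * p - 1 < δ ∧ δ < 2 * p - 1 := by
  have hmem := memLpPow_indicator δ hp le_rfl
  have hne : ∫⁻ x, WexoMax ν ((Ioo 1 (1 + 1)).indicator 1) x ^ p ∂(powMeasure δ) ≠ ⊤ :=
    ((h _ hmem).trans_lt (ENNReal.mul_lt_top coe_lt_top hmem.2)).ne
  constructor
  · by_contra! hδ
    obtain ⟨c, hc, hle⟩ := exists_le_WexoMax_near_zero hν
    exact hne <| lintegral_powMeasure_eq_top hp.le hc measurableSet_Ioo Ioo_subset_Ioi_self hle
      (lintegral_Ioo_rpow_eq_top (by linarith))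
  · by_contra! hδ
    obtain ⟨c, hc, hle⟩ := exists_le_WexoMax_near_top hν
    exact hne <| lintegral_powMeasure_eq_top hp.le hc measurableSet_Ioi
      (Ioi_subset_Ioi zero_le_two) hle (lintegral_Ioi_rpow_eq_top (by linarith))

lemma not_lintegral_WexoMax_le {ν δ : ℝ} (hν : ν < 1) (C : ℝ≥0) :
    ¬ ∀ f : ℝ → ℝ, MemLpPow f 1 δ → ∫⁻ x, WexoMax ν f x ^ (1 : ℝ) ∂(powMeasure δ) ≤
      C * ∫⁻ x, ENNReal.ofReal |f x| ^ (1 : ℝ) ∂(powMeasure δ) := by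
  intro h
  obtain ⟨c, hc, hle⟩ := exists_le_WexoMax_near_one hν
  have hC : (0 : ℝ) ≤ C := C.coe_nonneg
  have key : ∀ ε : ℝ, 0 < ε → ε < 1 → c * 2 ^ (-|δ|) * Real.log ε⁻¹ ≤ C * 2 ^ |δ| := by
    intro ε h0 h1
    have hlog : 0 ≤ Real.log ε⁻¹ := Real.log_nonneg (by rw [one_le_inv₀ h0]; exact h1.le)
    have hfin := (h _ (memLpPow_indicator δ one_pos h1.le)).trans
      (mul_le_mul_right (lintegral_indicator_powMeasure_le δ one_pos h1.le) _)
    have hlow : ENNReal.ofReal (c * ε * 2 ^ (-|δ|) * Real.log ε⁻¹) ≤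
        ∫⁻ x, WexoMax ν ((Ioo 1 (1 + ε)).indicator 1) x ^ (1 : ℝ) ∂(powMeasure δ) := by
      rw [lintegral_powMeasure, ENNReal.ofReal_mul (by positivity),
        ← lintegral_Ioo_sub_one_inv h0 h1, ← lintegral_const_mul' _ _ ofReal_ne_top]
      have hsub : Ioo (1 + ε) 2 ⊆ Ioi 0 := fun x hx => by
        have := hx.1
        exact mem_Ioi.mpr (by linarith)
      refine le_trans ?_ (lintegral_mono_set hsub)
      refine setLIntegral_mono' measurableSet_Ioo fun x hx => ?_
      rw [ENNReal.rpow_one]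
      have hx1 : 0 < x - 1 := by linarith [hx.1]
      calc _ = ENNReal.ofReal (c * ε * (x - 1)⁻¹) * ENNReal.ofReal (2 ^ (-|δ|)) := by
            rw [← ENNReal.ofReal_mul (by positivity), ← ENNReal.ofReal_mul (by positivity)]
            congr 1; ring
        _ ≤ _ := by
            gcongr
            · exact hle ε h0 x hx
            · exact rpow_neg_abs_le_rpow δ (by linarith) hx.2.le
    have h2 := hlow.trans hfin
    rw [← ENNReal.ofReal_coe_nnreal, ← ENNReal.ofReal_mul hC,
      ENNReal.ofReal_le_ofReal_iff (by positivity)] at h2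
    refine le_of_mul_le_mul_right ?_ h0
    linarith
  set N : ℝ := (C * 2 ^ |δ| + 1) / (c * 2 ^ (-|δ|)) with hN
  have hN0 : 0 < N := by positivity
  have h3 := key (Real.exp (-N)) (Real.exp_pos _) (by rw [Real.exp_lt_one_iff]; linarith)
  rw [← Real.exp_neg, neg_neg, Real.log_exp, hN, mul_div_cancel₀ _ (by positivity)] at h3
  linarith

lemma not_essSup_WexoMax_le {ν : ℝ} (hν0 : 0 < ν) (hν : ν < 1) (C : ℝ≥0) :
    ¬ ∀ f : ℝ → ℝ, essSup (WexoMax ν f) (volume.restrict (Ioi (0 : ℝ))) ≤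
      C * eLpNorm f ⊤ (volume.restrict (Ioi (0 : ℝ))) := by
  intro h
  obtain ⟨c, hc, hle⟩ := exists_le_WexoMax_near_zero hν
  set f : ℝ → ℝ := (Ioo 1 (1 + 1)).indicator 1 with hf
  have hf1 : eLpNorm f ⊤ (volume.restrict (Ioi (0 : ℝ))) ≤ 1 := by
    rw [eLpNorm_exponent_top, ← ENNReal.ofReal_one]
    refine eLpNormEssSup_le_of_ae_bound (Filter.Eventually.of_forall fun x => ?_)
    rw [hf]
    exact (norm_indicator_le_norm_self _ _).trans (by simp)
  have hae : ∀ᵐ x ∂volume.restrict (Ioo (0 : ℝ) 1), WexoMax ν f x ≤ C := by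
    refine ae_restrict_of_ae_restrict_of_subset Ioo_subset_Ioi_self ?_
    filter_upwards [ENNReal.ae_le_essSup (μ := volume.restrict (Ioi (0 : ℝ))) (WexoMax ν f)]
      with x hx
    exact hx.trans ((h f).trans (mul_le_of_le_one_right' hf1))
  set q : ℝ := (2 * ν)⁻¹ with hq
  have hq0 : 0 < q := by positivity
  have htop :
      ENNReal.ofReal (c ^ q) * ∫⁻ x in Ioo (0 : ℝ) 1, ENNReal.ofReal (x ^ (-1 : ℝ)) = ⊤ := by
    rw [lintegral_Ioo_rpow_eq_top le_rfl, ENNReal.mul_top]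
    have : 0 < c ^ q := by positivity
    simpa using this
  have hle' : ENNReal.ofReal (c ^ q) * ∫⁻ x in Ioo (0 : ℝ) 1, ENNReal.ofReal (x ^ (-1 : ℝ)) ≤
      ∫⁻ x in Ioo (0 : ℝ) 1, (C : ℝ≥0∞) ^ q := by
    rw [← lintegral_const_mul' _ _ ofReal_ne_top]
    refine lintegral_mono_ae ?_
    filter_upwards [hae, ae_restrict_mem measurableSet_Ioo] with x hx hx01
    have hx0 : 0 < x := hx01.1
    refine le_trans (le_of_eq ?_) (ENNReal.rpow_le_rpow ((hle x hx01).trans hx) hq0.le)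
    rw [ENNReal.ofReal_rpow_of_nonneg (by positivity) hq0.le, ← ENNReal.ofReal_mul (by positivity),
      Real.mul_rpow hc.le (by positivity), ← Real.rpow_mul hx0.le, hq, neg_mul,
      mul_inv_cancel₀ (by positivity)]
  rw [htop, setLIntegral_const, Real.volume_Ioo, top_le_iff] at hle'
  exact ENNReal.mul_ne_top (ENNReal.rpow_ne_top_of_nonneg hq0.le coe_ne_top) ofReal_ne_top hle'

theorem stmt12 (ν δ : ℝ) (hν0 : ν ≠ 0) (hν1 : ν < 1) :
    -- strong type (p,p), 1 ≤ p < ∞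
    (∀ p : ℝ, 1 ≤ p →
      ((∃ C : ℝ≥0, ∀ f : ℝ → ℝ, MemLpPow f p δ →
          ∫⁻ x, WexoMax ν f x ^ p ∂(powMeasure δ) ≤
            C * ∫⁻ x, ENNReal.ofReal |f x| ^ p ∂(powMeasure δ)) ↔
        (1 < p ∧ 2 * ν * p - 1 < δ ∧ δ < 2 * p - 1))) ∧
    -- strong type (∞,∞)
    ((∃ C : ℝ≥0, ∀ f : ℝ → ℝ,
        essSup (WexoMax ν f) (volume.restrict (Ioi (0:ℝ))) ≤
          C * eLpNorm f ⊤ (volume.restrict (Ioi (0:ℝ)))) ↔ ν < 0) := by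
  refine ⟨fun p hp => ⟨fun ⟨C, hC⟩ => ⟨?_, lt_of_lintegral_WexoMax_rpow_le hν1 (by linarith) hC⟩,
    fun ⟨h0, h1, h2⟩ => exists_lintegral_WexoMax_rpow_le hν1 h0 h1 h2⟩,
    fun ⟨C, hC⟩ => ?_, exists_essSup_WexoMax_le⟩
  · refine lt_of_le_of_ne hp ?_
    rintro rfl
    exact not_lintegral_WexoMax_le hν1 C hC
  · by_contra hν
    exact not_essSup_WexoMax_le (lt_of_le_of_ne (not_lt.mp hν) hν0.symm) hν1 C hC

end
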